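/- Let L be a C^k (k ≥ 2) Tonelli Lagrangian on T𝕋ⁿ without conjugate points. For every T > 0 and every x ∈ ℝⁿ, the unique extremal curve c : ℝ → ℝⁿ with c(0) = x and c(T) = x satisfies c'(0) = 0; in other words, the set Γ_{T,0} of initial velocities of the T-periodic extremal curves of homotopy class 0 is the zero section {(x, 0) : x ∈ ℝⁿ}. -/

import Mathlib

open MeasureTheory
open scoped NNReal

noncomputable section

abbrev E (n : ℕ) : Type := Fin n → ℝ

/-- The vector of `ℝⁿ` whose coordinates are the integers `m i`. -/
def intVec {n : ℕ} (m : Fin n → ℤ) : E n := fun i => (m i : ℝ)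

/-- A Tonelli Lagrangian on `T𝕋ⁿ`, identified with a `ℤⁿ`-periodic (in `x`) function
on `ℝⁿ × ℝⁿ` which is `Cᵏ`, uniformly superlinear in `v` and with positive definite
fiberwise Hessian. -/
structure IsTonelliLagrangian (n : ℕ) (k : ℕ∞) (L : E n × E n → ℝ) : Prop where
  smooth : ContDiff ℝ k L
  periodic : ∀ (x v : E n) (m : Fin n → ℤ), L (x + intVec m, v) = L (x, v)
  superlinear : ∀ C : ℝ, ∃ R : ℝ, ∀ (x v : E n), R ≤ ‖v‖ → C * ‖v‖ ≤ L (x, v)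
  posdef : ∀ (x v w : E n), w ≠ 0 →
    0 < fderiv ℝ (fun v' => fderiv ℝ (fun v'' => L (x, v'')) v' w) v w

/-- Partial differential of `L` in the fiber (velocity) direction. -/
def partialV (n : ℕ) (L : E n × E n → ℝ) (x v : E n) : E n →L[ℝ] ℝ :=
  fderiv ℝ (fun v' => L (x, v')) v

/-- Partial differential of `L` in the base (position) direction. -/
def partialX (n : ℕ) (L : E n × E n → ℝ) (x v : E n) : E n →L[ℝ] ℝ :=
  fderiv ℝ (fun x' => L (x', v)) x

/-- A `C²` curve satisfying the Euler–Lagrange equation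
`d/dt (∂L/∂v(γ, γ')) = ∂L/∂x(γ, γ')`. -/
def IsExtremal (n : ℕ) (L : E n × E n → ℝ) (γ : ℝ → E n) : Prop :=
  ContDiff ℝ 2 γ ∧
  ∀ t : ℝ, HasDerivAt (fun s => partialV n L (γ s) (deriv γ s))
    (partialX n L (γ t) (deriv γ t)) t

/-- `φ` is the (complete, `C^{k-1}`) Euler–Lagrange flow of `L` on `ℝⁿ × ℝⁿ`:
`φ t (x,v) = (γ t, γ' t)` where `γ` is the extremal curve with `(γ 0, γ' 0) = (x, v)`. -/
def IsELFlow (n : ℕ) (k : ℕ) (L : E n × E n → ℝ)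
    (φ : ℝ → E n × E n → E n × E n) : Prop :=
  ContDiff ℝ ((k - 1 : ℕ) : ℕ∞) (fun p : ℝ × (E n × E n) => φ p.1 p.2) ∧
  (∀ z : E n × E n, φ 0 z = z) ∧
  ∀ x v : E n, IsExtremal n L (fun t => (φ t (x, v)).1) ∧
    ∀ t : ℝ, (φ t (x, v)).2 = deriv (fun s => (φ s (x, v)).1) t

/-- The flow `φ` has no conjugate points: for `t ≠ 0` the image of the vertical
subspace `{0} × ℝⁿ` under `Dφ_t(z)` meets `{0} × ℝⁿ` only in `0`. -/
def NoConjugatePoints (n : ℕ) (φ : ℝ → E n × E n → E n × E n) : Prop :=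
  ∀ (z : E n × E n) (t : ℝ), t ≠ 0 → ∀ w : E n,
    (fderiv ℝ (φ t) z (0, w)).1 = 0 → w = 0

/-- The absolutely continuous curve starting at `x` with derivative `g`. -/
def curveOf (n : ℕ) (x : E n) (g : ℝ → E n) : ℝ → E n :=
  fun s => x + ∫ u in (0:ℝ)..s, g u

/-- `Acost n L t x y` = the infimum of the Lagrangian action over all absolutely
continuous curves `c : [0,t] → ℝⁿ` with `c 0 = x` and `c t = y`. -/
def Acost (n : ℕ) (L : E n × E n → ℝ) (t : ℝ) (x y : E n) : ℝ :=
  sInf { A : ℝ | ∃ g : ℝ → E n,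
    IntervalIntegrable g volume 0 t ∧
    curveOf n x g t = y ∧
    IntervalIntegrable (fun s => L (curveOf n x g s, g s)) volume 0 t ∧
    A = ∫ s in (0:ℝ)..t, L (curveOf n x g s, g s) }

theorem IsTonelliLagrangian.contDiff_two {n k : ℕ} (hk : 2 ≤ k) {L : E n × E n → ℝ}
    (hL : IsTonelliLagrangian n (k : ℕ∞) L) : ContDiff ℝ 2 L :=
  hL.smooth.of_le (show ((2 : ℕ∞) : WithTop ℕ∞) ≤ _ from
    WithTop.coe_le_coe.2 (by exact_mod_cast hk))

section Lagrangian

variable {n : ℕ} {L : E n × E n → ℝ}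

theorem partialV_eq (h : Differentiable ℝ L) (x v : E n) :
    partialV n L x v = (fderiv ℝ L (x, v)).comp (ContinuousLinearMap.inr ℝ (E n) (E n)) := by
  have h1 : HasFDerivAt (fun v' : E n => ((x, v') : E n × E n))
      (ContinuousLinearMap.inr ℝ (E n) (E n)) v := hasFDerivAt_prodMk_right x v
  exact ((h (x, v)).hasFDerivAt.comp v h1).fderiv

theorem partialX_eq (h : Differentiable ℝ L) (x v : E n) :
    partialX n L x v = (fderiv ℝ L (x, v)).comp (ContinuousLinearMap.inl ℝ (E n) (E n)) := by
  have h1 : HasFDerivAt (fun x' : E n => ((x', v) : E n × E n))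
      (ContinuousLinearMap.inl ℝ (E n) (E n)) x := hasFDerivAt_prodMk_left x v
  exact ((h (x, v)).hasFDerivAt.comp x h1).fderiv

theorem fderiv_eq_partial (h : Differentiable ℝ L) (x v a b : E n) :
    fderiv ℝ L (x, v) (a, b) = partialX n L x v a + partialV n L x v b := by
  rw [partialX_eq h, partialV_eq h]
  simp [← map_add]

theorem contDiff_partialV (h : ContDiff ℝ 2 L) :
    ContDiff ℝ 1 (fun z : E n × E n => partialV n L z.1 z.2) := by
  simp_rw [partialV_eq (h.differentiable (by norm_num))]
  exact (h.fderiv_right (m := 1) (by norm_num)).clm_comp contDiff_const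

theorem contDiff_partialX (h : ContDiff ℝ 2 L) :
    ContDiff ℝ 1 (fun z : E n × E n => partialX n L z.1 z.2) := by
  simp_rw [partialX_eq (h.differentiable (by norm_num))]
  exact (h.fderiv_right (m := 1) (by norm_num)).clm_comp contDiff_const

/-- Positivity of the fiberwise Hessian, in the direction of a nonzero vector. -/
def FiberwisePosDef (n : ℕ) (L : E n × E n → ℝ) : Prop :=
  ∀ x v w : E n, w ≠ 0 → 0 < fderiv ℝ (fun v' => partialV n L x v' w) v w

theorem strictMono_partialV_line (h : ContDiff ℝ 2 L) (hp : FiberwisePosDef n L)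
    (x v w : E n) (hw : w ≠ 0) :
    StrictMono (fun r : ℝ => partialV n L x (v + r • w) w) := by
  refine strictMono_of_deriv_pos fun r => ?_
  have hd : Differentiable ℝ (fun v' => partialV n L x v' w) := by
    have h1 : ContDiff ℝ 1 (fun v' => partialV n L x v') :=
      (contDiff_partialV h).comp (contDiff_const.prodMk contDiff_id)
    exact (h1.clm_apply contDiff_const).differentiable (by norm_num)
  have h2 : HasDerivAt (fun r : ℝ => v + r • w) w r := by
    simpa using ((hasDerivAt_id r).smul_const w).const_add v
  have h3 := (hd (v + r • w)).hasFDerivAt.comp_hasDerivAt r h2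
  have h4 := h3.deriv
  simp only [Function.comp_def] at h4
  rw [h4]
  exact hp x _ w hw

theorem partialV_injective (h : ContDiff ℝ 2 L) (hp : FiberwisePosDef n L) (x : E n) :
    Function.Injective (partialV n L x) := by
  intro v w hvw
  by_contra hne
  have := strictMono_partialV_line h hp x v (w - v) (sub_ne_zero.2 (Ne.symm hne)) zero_lt_one
  simp [hvw] at this

theorem add_partialV_le (h : ContDiff ℝ 2 L) (hp : FiberwisePosDef n L) (x v w : E n) :
    L (x, v) + partialV n L x v (w - v) ≤ L (x, w) := by
  rcases eq_or_ne w v with rfl | hne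
  · simp
  have hm := strictMono_partialV_line h hp x v (w - v) (sub_ne_zero.2 hne)
  have hder : ∀ r : ℝ, HasDerivAt (fun r : ℝ => L (x, v + r • (w - v)))
      (partialV n L x (v + r • (w - v)) (w - v)) r := by
    intro r
    have h2 : HasDerivAt (fun r : ℝ => ((x, v + r • (w - v)) : E n × E n)) (0, w - v) r := by
      refine (hasDerivAt_const r x).prodMk ?_
      simpa using ((hasDerivAt_id r).smul_const (w - v)).const_add v
    have h3 := (h.differentiable (by norm_num) (x, v + r • (w - v))).hasFDerivAt.comp_hasDerivAt r h2
    rw [fderiv_eq_partial (h.differentiable (by norm_num))] at h3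
    rw [map_zero, zero_add] at h3
    exact h3
  obtain ⟨r, hr, hr'⟩ := exists_hasDerivAt_eq_slope (fun r : ℝ => L (x, v + r • (w - v))) _
    zero_lt_one (fun r _ => (hder r).continuousAt.continuousWithinAt) (fun r _ => hder r)
  have := hm hr.1
  simp only [zero_smul, add_zero, one_smul, add_sub_cancel, sub_zero, div_one] at this hr'
  linarith

/-- The Legendre map `(x, v) ↦ (x, ∂L/∂v)`, with covectors given by their coordinates. -/
def legendre (n : ℕ) (L : E n × E n → ℝ) (z : E n × E n) : E n × E n :=
  (z.1, fun i => partialV n L z.1 z.2 (Pi.single i 1))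

theorem contDiff_legendre (h : ContDiff ℝ 2 L) : ContDiff ℝ 1 (legendre n L) :=
  contDiff_fst.prodMk (contDiff_pi.2 fun _ => (contDiff_partialV h).clm_apply contDiff_const)

theorem fderiv_legendre_injective (h : ContDiff ℝ 2 L) (hp : FiberwisePosDef n L)
    (z : E n × E n) : Function.Injective (fderiv ℝ (legendre n L) z) := by
  refine (injective_iff_map_eq_zero _).2 ?_
  rintro ⟨a, b⟩ hab
  have hd : HasFDerivAt (legendre n L) (fderiv ℝ (legendre n L) z) z :=
    ((contDiff_legendre h).differentiable (by norm_num) z).hasFDerivAt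
  have ha : a = 0 := by
    have h1 := hd.fst.unique (hasFDerivAt_fst (𝕜 := ℝ) (p := z))
    have h2 := congrArg (fun f => f (a, b)) h1
    simp [hab] at h2
    exact h2.symm
  subst ha
  by_contra hb
  have hb : b ≠ 0 := fun h0 => hb (by simp [h0])
  have h2 : HasDerivAt (fun r : ℝ => ((z.1, z.2 + r • b) : E n × E n)) (0, b) 0 := by
    refine (hasDerivAt_const _ z.1).prodMk ?_
    simpa using ((hasDerivAt_id (0:ℝ)).smul_const b).const_add z.2
  have h3 : HasDerivAt (fun r : ℝ => legendre n L (z.1, z.2 + r • b)) 0 0 := by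
    have := HasFDerivAt.comp_hasDerivAt (0:ℝ) (by simpa using hd) h2
    rwa [hab] at this
  have h4 : HasDerivAt (fun r : ℝ => partialV n L z.1 (z.2 + r • b) b) 0 0 := by
    have h5 := fun i => (hasDerivAt_pi.1 h3.snd i).const_mul (b i)
    have h6 := HasDerivAt.fun_sum (u := Finset.univ) fun i _ => h5 i
    simp only [Prod.snd_zero, Pi.zero_apply, mul_zero, Finset.sum_const_zero] at h6
    have h7 : ∀ f : E n →L[ℝ] ℝ, f b = ∑ i, b i * f (Pi.single i 1) := fun f => by
      conv_lhs => rw [← Finset.univ_sum_single b, map_sum]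
      refine Finset.sum_congr rfl fun i _ => ?_
      rw [← smul_eq_mul, ← map_smul, ← Pi.single_smul, smul_eq_mul, mul_one]
    simp_rw [h7 (partialV n L _ _)]
    exact h6
  have hd' : Differentiable ℝ (fun v' => partialV n L z.1 v' b) := by
    have h1 : ContDiff ℝ 1 (fun v' => partialV n L z.1 v') :=
      (contDiff_partialV h).comp (contDiff_const.prodMk contDiff_id)
    exact (h1.clm_apply contDiff_const).differentiable (by norm_num)
  have h7 := HasFDerivAt.comp_hasDerivAt (0:ℝ) (hd' (z.2 + (0:ℝ) • b)).hasFDerivAt h2.snd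
  have h8 := h7.unique h4
  have h9 := hp z.1 (z.2 + (0:ℝ) • b) b hb
  simp only [h8] at h9
  exact lt_irrefl _ h9

end Lagrangian

section Extremals

variable {n : ℕ} {L : E n × E n → ℝ}

/-- An injective derivative of a self-map of a finite-dimensional space is invertible. -/
theorem exists_equiv_of_injective {F : Type*} [NormedAddCommGroup F] [NormedSpace ℝ F]
    [FiniteDimensional ℝ F] (f : F →L[ℝ] F) (hf : Function.Injective f) :
    ∃ e : F ≃L[ℝ] F, (e : F →L[ℝ] F) = f :=
  ⟨(LinearEquiv.ofInjectiveEndo (f : F →ₗ[ℝ] F) hf).toContinuousLinearEquiv, by ext; rfl⟩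

/-- The inverse function theorem for a `C¹` self-map of a finite-dimensional space. -/
theorem exists_openPartialHomeomorph {F : Type*} [NormedAddCommGroup F] [NormedSpace ℝ F]
    [FiniteDimensional ℝ F] {f : F → F} (hf : ContDiff ℝ 1 f) (z : F)
    (hinj : Function.Injective (fderiv ℝ f z)) :
    ∃ e : OpenPartialHomeomorph F F, (e : F → F) = f ∧ z ∈ e.source ∧
      ContDiffAt ℝ 1 e.symm (f z) := by
  have : CompleteSpace F := FiniteDimensional.complete ℝ F
  obtain ⟨f', hf'⟩ := exists_equiv_of_injective _ hinj
  have hd : HasFDerivAt f (f' : F →L[ℝ] F) z := by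
    rw [hf']
    exact (hf.differentiable (by norm_num) z).hasFDerivAt
  refine ⟨hf.contDiffAt.toOpenPartialHomeomorph f hd (by norm_num), rfl,
    hf.contDiffAt.mem_toOpenPartialHomeomorph_source hd (by norm_num), ?_⟩
  exact hf.contDiffAt.to_localInverse hd (by norm_num)

theorem IsExtremal.hasDerivAt {c : ℝ → E n} (hc : IsExtremal n L c) (t : ℝ) :
    HasDerivAt c (deriv c t) t :=
  (hc.1.differentiable (by norm_num) t).hasDerivAt

theorem IsExtremal.continuous_deriv {c : ℝ → E n} (hc : IsExtremal n L c) :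
    Continuous (deriv c) :=
  hc.1.continuous_deriv (by norm_num)

theorem IsExtremal.eventuallyEq (h : ContDiff ℝ 2 L) (hp : FiberwisePosDef n L)
    {c₁ c₂ : ℝ → E n} (h₁ : IsExtremal n L c₁) (h₂ : IsExtremal n L c₂) {t₀ : ℝ}
    (hc : c₁ t₀ = c₂ t₀) (hd : deriv c₁ t₀ = deriv c₂ t₀) :
    (fun t => (c₁ t, deriv c₁ t)) =ᶠ[nhds t₀] fun t => (c₂ t, deriv c₂ t) := by
  obtain ⟨e, he, hz, hs⟩ := exists_openPartialHomeomorph (contDiff_legendre h)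
    (c₁ t₀, deriv c₁ t₀) (fderiv_legendre_injective h hp _)
  set W : E n × E n → E n × E n :=
    fun z => (z.2, fun i => partialX n L z.1 z.2 (Pi.single i 1)) with hW
  have hWc : ContDiff ℝ 1 W :=
    contDiff_snd.prodMk (contDiff_pi.2 fun _ => (contDiff_partialX h).clm_apply contDiff_const)
  obtain ⟨K, s, hs', hK⟩ := (hWc.contDiffAt.comp _ hs).exists_lipschitzOnWith
  have key : ∀ c : ℝ → E n, IsExtremal n L c → (c t₀, deriv c t₀) = (c₁ t₀, deriv c₁ t₀) →
      ∀ᶠ t in nhds t₀, (HasDerivAt (fun t => legendre n L (c t, deriv c t))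
        ((W ∘ e.symm) (legendre n L (c t, deriv c t))) t ∧
          legendre n L (c t, deriv c t) ∈ s) ∧
        e.symm (legendre n L (c t, deriv c t)) = (c t, deriv c t) := by
    intro c hce hcc
    have hcont : Continuous (fun t => (c t, deriv c t)) :=
      hce.1.continuous.prodMk hce.continuous_deriv
    have m1 : ∀ᶠ t in nhds t₀, (c t, deriv c t) ∈ e.source :=
      hcont.continuousAt.eventually_mem (e.open_source.mem_nhds (by rw [hcc]; exact hz))
    have m2 : ∀ᶠ t in nhds t₀, legendre n L (c t, deriv c t) ∈ s :=
      ((contDiff_legendre h).continuous.comp hcont).continuousAt.eventually_mem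
        (by simpa only [Function.comp, hcc] using hs')
    filter_upwards [m1, m2] with t ht1 ht2
    have hl : e.symm (legendre n L (c t, deriv c t)) = (c t, deriv c t) := by
      rw [← he]; exact e.left_inv ht1
    refine ⟨⟨?_, ht2⟩, hl⟩
    rw [Function.comp, hl]
    refine (hce.hasDerivAt t).prodMk (hasDerivAt_pi.2 fun i => ?_)
    exact ((hce.2 t).clm_apply (hasDerivAt_const t _)).congr_deriv (by simp)
  have k1 := key c₁ h₁ rfl
  have k2 := key c₂ h₂ (by rw [hc, hd])
  have hu := ODE_solution_unique_of_eventually (v := fun _ => W ∘ e.symm) (s := fun _ => s)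
    (Filter.Eventually.of_forall fun _ => hK) (k1.mono fun _ h => h.1) (k2.mono fun _ h => h.1)
    (by rw [hc, hd])
  filter_upwards [hu, k1, k2] with t ht h1 h2
  rw [← h1.2, ← h2.2, ht]

/-- Extremal curves are determined by their position and velocity at one time. -/
theorem IsExtremal.eq_of_eq (h : ContDiff ℝ 2 L) (hp : FiberwisePosDef n L)
    {c₁ c₂ : ℝ → E n} (h₁ : IsExtremal n L c₁) (h₂ : IsExtremal n L c₂) {t₀ : ℝ}
    (hc : c₁ t₀ = c₂ t₀) (hd : deriv c₁ t₀ = deriv c₂ t₀) : c₁ = c₂ := by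
  have hclosed : IsClosed {t | (c₁ t, deriv c₁ t) = (c₂ t, deriv c₂ t)} :=
    isClosed_eq (h₁.1.continuous.prodMk h₁.continuous_deriv)
      (h₂.1.continuous.prodMk h₂.continuous_deriv)
  have hopen : IsOpen {t | (c₁ t, deriv c₁ t) = (c₂ t, deriv c₂ t)} := by
    refine isOpen_iff_mem_nhds.2 fun t ht => ?_
    obtain ⟨ha, hb⟩ := Prod.mk.inj ht
    exact IsExtremal.eventuallyEq h hp h₁ h₂ ha hb
  have huniv := IsClopen.eq_univ ⟨hclosed, hopen⟩ ⟨t₀, Prod.ext hc hd⟩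
  funext t
  exact (Prod.mk.inj (huniv.symm ▸ Set.mem_univ t :
    t ∈ {t | (c₁ t, deriv c₁ t) = (c₂ t, deriv c₂ t)})).1

theorem IsExtremal.comp_add_const {c : ℝ → E n} (hc : IsExtremal n L c) (s : ℝ) :
    IsExtremal n L (fun t => c (t + s)) := by
  refine ⟨hc.1.comp (contDiff_id.add contDiff_const), fun t => ?_⟩
  have hd : ∀ t, deriv (fun t => c (t + s)) t = deriv c (t + s) := fun t =>
    deriv_comp_add_const c s t
  simp only [hd]
  exact (hc.2 (t + s)).comp_add_const t s

theorem partialV_add_intVec (hper : ∀ (x v : E n) (m : Fin n → ℤ), L (x + intVec m, v) = L (x, v))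
    (x v : E n) (m : Fin n → ℤ) : partialV n L (x + intVec m) v = partialV n L x v := by
  simp only [partialV, hper]

theorem partialX_add_intVec (hper : ∀ (x v : E n) (m : Fin n → ℤ), L (x + intVec m, v) = L (x, v))
    (x v : E n) (m : Fin n → ℤ) : partialX n L (x + intVec m) v = partialX n L x v := by
  have := fderiv_comp_add_right (𝕜 := ℝ) (f := fun x' : E n => L (x', v)) (x := x) (intVec m)
  simp only [hper] at this
  exact this.symm

theorem IsExtremal.add_intVec
    (hper : ∀ (x v : E n) (m : Fin n → ℤ), L (x + intVec m, v) = L (x, v))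
    {c : ℝ → E n} (hc : IsExtremal n L c) (m : Fin n → ℤ) :
    IsExtremal n L (fun t => c t + intVec m) := by
  refine ⟨hc.1.add contDiff_const, fun t => ?_⟩
  simp only [deriv_add_const, partialV_add_intVec hper, partialX_add_intVec hper]
  exact hc.2 t

end Extremals

section ParametricIntegral

variable {H F : Type*} [NormedAddCommGroup H] [NormedSpace ℝ H] [FiniteDimensional ℝ H]
  [NormedAddCommGroup F] [NormedSpace ℝ F]

theorem hasFDerivAt_intervalIntegral_of_contDiff {g : H × ℝ → F} (hg : ContDiff ℝ 1 g)
    (a b : ℝ) (p : H) :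
    HasFDerivAt (fun p => ∫ u in a..b, g (p, u))
      (∫ u in a..b, (fderiv ℝ g (p, u)).comp (ContinuousLinearMap.inl ℝ H ℝ)) p := by
  have : ProperSpace H := FiniteDimensional.proper ℝ H
  have hc' : Continuous fun q : H × ℝ => (fderiv ℝ g q).comp (ContinuousLinearMap.inl ℝ H ℝ) :=
    (hg.continuous_fderiv (by norm_num)).clm_comp continuous_const
  obtain ⟨C, hC⟩ := ((isCompact_closedBall p 1).prod (isCompact_uIcc (a := a) (b := b)))
    |>.exists_bound_of_continuousOn hc'.continuousOn
  refine intervalIntegral.hasFDerivAt_integral_of_dominated_of_fderiv_le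
    (F' := fun p u => (fderiv ℝ g (p, u)).comp (ContinuousLinearMap.inl ℝ H ℝ))
    (bound := fun _ => C) (Metric.closedBall_mem_nhds p one_pos)
    (Filter.Eventually.of_forall fun q => ?_) ?_ ?_ ?_ ?_ ?_
  · exact (hg.continuous.comp (Continuous.prodMk_right q)).aestronglyMeasurable
  · exact (hg.continuous.comp (Continuous.prodMk_right p)).intervalIntegrable _ _
  · exact (hc'.comp (Continuous.prodMk_right p)).aestronglyMeasurable
  · exact Filter.Eventually.of_forall fun u hu q hq =>
      hC (q, u) ⟨hq, Set.uIoc_subset_uIcc hu⟩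
  · exact intervalIntegrable_const
  · exact Filter.Eventually.of_forall fun u _ q _ =>
      ((hg.differentiable (by norm_num) (q, u)).hasFDerivAt).comp q (hasFDerivAt_prodMk_left q u)

theorem contDiff_intervalIntegral [CompleteSpace F] {g : H × ℝ → F} (hg : ContDiff ℝ 1 g) (a b : ℝ) :
    ContDiff ℝ 1 (fun p => ∫ u in a..b, g (p, u)) := by
  refine contDiff_one_iff_hasFDerivAt.2
    ⟨_, ?_, hasFDerivAt_intervalIntegral_of_contDiff hg a b⟩
  exact intervalIntegral.continuous_parametric_intervalIntegral_of_continuous'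
    (f := fun p u => (fderiv ℝ g (p, u)).comp (ContinuousLinearMap.inl ℝ H ℝ))
    ((hg.continuous_fderiv (by norm_num)).clm_comp continuous_const) _ _

/-- The average of `f (·, v)` over the time interval between `0` and `t`. -/
def timeAverage {V F : Type*} [NormedAddCommGroup F] [NormedSpace ℝ F]
    (f : ℝ × V → F) (p : ℝ × V) : F :=
  ∫ u in (0:ℝ)..1, f (u * p.1, p.2)

variable {V : Type*} [NormedAddCommGroup V] [NormedSpace ℝ V] [FiniteDimensional ℝ V]

omit [FiniteDimensional ℝ V] in
theorem contDiff_scaleTime {f : ℝ × V → F} (hf : ContDiff ℝ 1 f) :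
    ContDiff ℝ 1 (fun q : (ℝ × V) × ℝ => f (q.2 * q.1.1, q.1.2)) :=
  hf.comp ((contDiff_snd.mul (contDiff_fst.comp contDiff_fst)).prodMk
    (contDiff_snd.comp contDiff_fst))

theorem contDiff_timeAverage [CompleteSpace F] {f : ℝ × V → F} (hf : ContDiff ℝ 1 f) :
    ContDiff ℝ 1 (timeAverage f) :=
  contDiff_intervalIntegral (contDiff_scaleTime hf) 0 1

omit [FiniteDimensional ℝ V] [NormedSpace ℝ V] [NormedAddCommGroup V] in
theorem smul_timeAverage (f : ℝ × V → F) (t : ℝ) (v : V) :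
    t • timeAverage f (t, v) = ∫ s in (0:ℝ)..t, f (s, v) := by
  simpa [timeAverage] using
    intervalIntegral.smul_integral_comp_mul_right (a := 0) (b := 1) (fun s => f (s, v)) t

theorem smul_fderiv_timeAverage [CompleteSpace F] {f : ℝ × V → F} (hf : ContDiff ℝ 1 f) (t : ℝ) (v w : V) :
    t • fderiv ℝ (timeAverage f) (t, v) (0, w) = ∫ s in (0:ℝ)..t, fderiv ℝ f (s, v) (0, w) := by
  have hg := contDiff_scaleTime hf
  have h1 := hasFDerivAt_intervalIntegral_of_contDiff hg 0 1 (t, v)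
  have h2 : fderiv ℝ (timeAverage f) (t, v) = _ := h1.fderiv
  have hc : Continuous fun u : ℝ => (fderiv ℝ
      (fun q : (ℝ × V) × ℝ => f (q.2 * q.1.1, q.1.2)) ((t, v), u)).comp
        (ContinuousLinearMap.inl ℝ (ℝ × V) ℝ) :=
    ((hg.continuous_fderiv (by norm_num)).comp (Continuous.prodMk_right _)).clm_comp
      continuous_const
  rw [h2, ContinuousLinearMap.intervalIntegral_apply (hc.intervalIntegrable _ _)]
  have h3 := intervalIntegral.smul_integral_comp_mul_right (a := 0) (b := 1)
    (fun s => fderiv ℝ f (s, v) (0, w)) t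
  rw [zero_mul, one_mul] at h3
  rw [← h3]
  congr 1
  refine intervalIntegral.integral_congr fun u _ => ?_
  have h4 : HasFDerivAt (fun q : (ℝ × V) × ℝ => (q.2 * q.1.1, q.1.2)) _ ((t, v), u) :=
    ((hasFDerivAt_snd (𝕜 := ℝ)).mul (hasFDerivAt_fst (𝕜 := ℝ)).fst).prodMk
      (hasFDerivAt_fst (𝕜 := ℝ)).snd
  have h5 : HasFDerivAt (fun q : (ℝ × V) × ℝ => f (q.2 * q.1.1, q.1.2)) _ ((t, v), u) :=
    HasFDerivAt.comp (g := f) ((t, v), u)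
      (hf.differentiable (by norm_num) (u * t, v)).hasFDerivAt h4
  simp [h5.fderiv]

end ParametricIntegral

/-- A Lagrangian together with its Euler–Lagrange flow, without conjugate points: the
properties used to study its extremal curves. -/
structure ConjugateFree (n : ℕ) (L : E n × E n → ℝ) (φ : ℝ → E n × E n → E n × E n) :
    Prop where
  contDiff : ContDiff ℝ 2 L
  posDef : FiberwisePosDef n L
  periodic : ∀ (x v : E n) (m : Fin n → ℤ), L (x + intVec m, v) = L (x, v)
  superlinear : ∀ C : ℝ, ∃ R : ℝ, ∀ (x v : E n), R ≤ ‖v‖ → C * ‖v‖ ≤ L (x, v)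
  contDiff_flow : ContDiff ℝ 1 (fun p : ℝ × (E n × E n) => φ p.1 p.2)
  flow_zero : ∀ z, φ 0 z = z
  extremal : ∀ z, IsExtremal n L (fun t => (φ t z).1)
  flow_snd : ∀ z t, (φ t z).2 = deriv (fun s => (φ s z).1) t
  noConj : NoConjugatePoints n φ

namespace ConjugateFree

variable {n : ℕ} {L : E n × E n → ℝ} {φ : ℝ → E n × E n → E n × E n} (hs : ConjugateFree n L φ)

include hs

theorem flow_eq {c : ℝ → E n} (hc : IsExtremal n L c) (t : ℝ) :
    φ t (c 0, deriv c 0) = (c t, deriv c t) := by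
  have h : (fun t => (φ t (c 0, deriv c 0)).1) = c :=
    IsExtremal.eq_of_eq hs.contDiff hs.posDef (hs.extremal _) hc (t₀ := 0)
      (by simp [hs.flow_zero]) (by rw [← hs.flow_snd, hs.flow_zero])
  refine Prod.ext (congrFun h t) ?_
  rw [hs.flow_snd, h]

theorem flow_add (t s : ℝ) (z : E n × E n) : φ t (φ s z) = φ (t + s) z := by
  have h := hs.flow_eq ((hs.extremal z).comp_add_const s) t
  have hd : ∀ t, deriv (fun t => (φ (t + s) z).1) t = (φ (t + s) z).2 := fun t => by
    rw [hs.flow_snd]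
    exact deriv_comp_add_const (fun t => (φ t z).1) s t
  simpa only [hd, zero_add] using h

theorem flow_add_intVec (t : ℝ) (x v : E n) (m : Fin n → ℤ) :
    φ t (x + intVec m, v) = ((φ t (x, v)).1 + intVec m, (φ t (x, v)).2) := by
  have h := hs.flow_eq ((hs.extremal (x, v)).add_intVec hs.periodic m) t
  simpa only [deriv_add_const, ← hs.flow_snd, hs.flow_zero] using h

omit hs in
theorem exists_add_intVec_mem (x : E n) :
    ∃ m : Fin n → ℤ, x + intVec m ∈ Set.Icc (0 : E n) 1 := by
  refine ⟨fun i => -⌊x i⌋, fun i => ?_, fun i => ?_⟩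
  · simpa [intVec] using Int.floor_le (x i)
  · have := (Int.lt_floor_add_one (x i)).le
    simp [intVec]
    linarith

/-- An orbit slow at some time in a bounded interval has bounded initial velocity. -/
theorem exists_velocity_bound (K T : ℝ) :
    ∃ R, ∀ s ∈ Set.Icc 0 T, ∀ z, ‖(φ s z).2‖ ≤ K → ‖z.2‖ ≤ R := by
  have hc : Continuous fun p : ℝ × (E n × E n) => (φ (-p.1) p.2).2 :=
    (hs.contDiff_flow.continuous.comp (continuous_fst.neg.prodMk continuous_snd)).snd
  obtain ⟨R, hR⟩ := ((isCompact_Icc (a := (0:ℝ)) (b := T)).prod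
    ((isCompact_Icc (a := (0 : E n)) (b := 1)).prod
      (isCompact_closedBall (0 : E n) K))).exists_bound_of_continuousOn hc.continuousOn
  refine ⟨R, fun s hsT z hz => ?_⟩
  obtain ⟨m, hm⟩ := exists_add_intVec_mem (φ s z).1
  have h1 := hR (s, ((φ s z).1 + intVec m, (φ s z).2)) ⟨hsT, hm, by simpa using hz⟩
  have h2 : φ (-s) ((φ s z).1 + intVec m, (φ s z).2) = (z.1 + intVec m, z.2) := by
    rw [hs.flow_add_intVec, Prod.mk.eta, hs.flow_add, neg_add_cancel, hs.flow_zero]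
  simpa only [h2] using h1

end ConjugateFree

section Field

variable {n : ℕ}

/-- The orbits issued from the points of the fiber over `x`. -/
def orbit (φ : ℝ → E n × E n → E n × E n) (x : E n) (p : ℝ × E n) : E n × E n :=
  φ p.1 (x, p.2)

/-- The mean velocity, over `[0, t]`, of the extremal curve with initial data `(x, v)`. -/
def meanVelocity (φ : ℝ → E n × E n → E n × E n) (x : E n) : ℝ × E n → E n :=
  timeAverage fun p => (orbit φ x p).2

/-- The mean action, over `[0, t]`, of the extremal curve with initial data `(x, v)`. -/
def meanAction (L : E n × E n → ℝ) (φ : ℝ → E n × E n → E n × E n) (x : E n) : ℝ × E n → ℝ :=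
  timeAverage fun p => L (orbit φ x p)

/-- The action, over `[0, t]`, of the extremal curve with initial data `(x, v)`. -/
def orbitAction (L : E n × E n → ℝ) (φ : ℝ → E n × E n → E n × E n) (x : E n)
    (p : ℝ × E n) : ℝ :=
  p.1 * meanAction L φ x p

/-- The exponential map at `x`, rescaled so as to be a local homeomorphism at time `0` too. -/
def blowup (φ : ℝ → E n × E n → E n × E n) (x : E n) (p : ℝ × E n) : ℝ × E n :=
  (p.1, meanVelocity φ x p)

end Field

namespace ConjugateFree

variable {n : ℕ} {L : E n × E n → ℝ} {φ : ℝ → E n × E n → E n × E n} (hs : ConjugateFree n L φ)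

include hs

theorem contDiff_orbit (x : E n) : ContDiff ℝ 1 (orbit φ x) :=
  hs.contDiff_flow.comp (contDiff_fst.prodMk (contDiff_const.prodMk contDiff_snd))

theorem contDiff_action (x : E n) : ContDiff ℝ 1 (fun p => L (orbit φ x p)) :=
  (hs.contDiff.of_le (by norm_num)).comp (hs.contDiff_orbit x)

theorem contDiff_meanVelocity (x : E n) : ContDiff ℝ 1 (meanVelocity φ x) :=
  contDiff_timeAverage (hs.contDiff_orbit x).snd

theorem contDiff_orbitAction (x : E n) : ContDiff ℝ 1 (orbitAction L φ x) :=
  contDiff_fst.mul (contDiff_timeAverage (hs.contDiff_action x))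

theorem contDiff_blowup (x : E n) : ContDiff ℝ 1 (blowup φ x) :=
  contDiff_fst.prodMk (hs.contDiff_meanVelocity x)

theorem hasDerivAt_orbit_fst (x v : E n) (t : ℝ) :
    HasDerivAt (fun s => (orbit φ x (s, v)).1) (orbit φ x (t, v)).2 t := by
  have := (hs.extremal (x, v)).hasDerivAt t
  rwa [← hs.flow_snd] at this

theorem continuous_orbit_time (x v : E n) : Continuous fun s => orbit φ x (s, v) :=
  (hs.contDiff_orbit x).continuous.comp (Continuous.prodMk_left v)

theorem add_smul_meanVelocity (x v : E n) (t : ℝ) :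
    x + t • meanVelocity φ x (t, v) = (orbit φ x (t, v)).1 := by
  rw [meanVelocity, smul_timeAverage, intervalIntegral.integral_eq_sub_of_hasDerivAt
    (fun s _ => hs.hasDerivAt_orbit_fst x v s)
    ((hs.continuous_orbit_time x v).snd.intervalIntegrable _ _)]
  simp [orbit, hs.flow_zero]

theorem meanVelocity_zero (x v : E n) : meanVelocity φ x (0, v) = v := by
  simp [meanVelocity, timeAverage, orbit, hs.flow_zero]

omit hs in
theorem orbitAction_eq (x v : E n) (t : ℝ) :
    orbitAction L φ x (t, v) = ∫ s in (0:ℝ)..t, L (orbit φ x (s, v)) :=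
  smul_timeAverage (fun p => L (orbit φ x p)) t v

theorem hasFDerivAt_orbit (x : E n) (p : ℝ × E n) :
    HasFDerivAt (orbit φ x) (fderiv ℝ (orbit φ x) p) p :=
  ((hs.contDiff_orbit x).differentiable (by norm_num) p).hasFDerivAt

theorem fderiv_orbit_fst (x v w : E n) (t : ℝ) :
    (fderiv ℝ (orbit φ x) (t, v) (0, w)).1 = t • fderiv ℝ (meanVelocity φ x) (t, v) (0, w) := by
  have h1 := (hs.hasFDerivAt_orbit x (t, v)).fst.comp v (hasFDerivAt_prodMk_right t v)
  have h2 := (((hs.contDiff_meanVelocity x).differentiable (by norm_num) (t, v)).hasFDerivAt.comp v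
    (hasFDerivAt_prodMk_right t v)).const_smul t |>.const_add x
  have h3 : (fun v => x + t • meanVelocity φ x (t, v)) = fun v => (orbit φ x (t, v)).1 :=
    funext fun v => hs.add_smul_meanVelocity x v t
  have h4 := h1.unique (h3 ▸ h2)
  simpa using congrArg (fun f => f w) h4

theorem hasDerivAt_fderiv_orbit_fst (x v w : E n) (t : ℝ) :
    HasDerivAt (fun s => (fderiv ℝ (orbit φ x) (s, v) (0, w)).1)
      (fderiv ℝ (orbit φ x) (t, v) (0, w)).2 t := by
  have hf : ∀ s, fderiv ℝ (fun p => (orbit φ x p).2) (s, v) (0, w)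
      = (fderiv ℝ (orbit φ x) (s, v) (0, w)).2 := fun s => by
    rw [(hs.hasFDerivAt_orbit x (s, v)).snd.fderiv]; rfl
  simp only [hs.fderiv_orbit_fst, meanVelocity, smul_fderiv_timeAverage (hs.contDiff_orbit x).snd, hf]
  have hc : Continuous fun s => (fderiv ℝ (orbit φ x) (s, v) (0, w)).2 :=
    ((((hs.contDiff_orbit x).continuous_fderiv (by norm_num)).comp
      (Continuous.prodMk_left v)).clm_apply continuous_const).snd
  exact hc.integral_hasStrictDerivAt 0 t |>.hasDerivAt

theorem fderiv_meanVelocity_injective (x v w : E n) (t : ℝ)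
    (h : fderiv ℝ (meanVelocity φ x) (t, v) (0, w) = 0) : w = 0 := by
  rcases eq_or_ne t 0 with rfl | ht
  · have h1 := ((hs.contDiff_meanVelocity x).differentiable (by norm_num)
      ((0:ℝ), v)).hasFDerivAt.comp v (hasFDerivAt_prodMk_right (0:ℝ) v)
    have h2 : (meanVelocity φ x ∘ fun v => ((0:ℝ), v)) = id :=
      funext fun v => hs.meanVelocity_zero x v
    have h3 := congrArg (fun f => f w) (h1.unique (h2 ▸ hasFDerivAt_id v))
    simpa [h] using h3.symm
  · refine hs.noConj (x, v) t ht w ?_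
    have h1 := (hs.hasFDerivAt_orbit x (t, v)).comp v (hasFDerivAt_prodMk_right t v)
    have h2 : HasFDerivAt (φ t) (fderiv ℝ (φ t) (x, v)) (x, v) :=
      ((hs.contDiff_flow.comp (contDiff_const.prodMk contDiff_id)).differentiable
        (by norm_num) (x, v)).hasFDerivAt
    have h3 := h1.unique (h2.comp v (hasFDerivAt_prodMk_right x v))
    have h4 := congrArg (fun f => (f w).1) h3
    have h5 := hs.fderiv_orbit_fst x v w t
    rw [h, smul_zero] at h5
    simpa [h5] using h4.symm

theorem fderiv_blowup_injective (x : E n) (p : ℝ × E n) :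
    Function.Injective (fderiv ℝ (blowup φ x) p) := by
  refine (injective_iff_map_eq_zero _).2 ?_
  rintro ⟨a, w⟩ h
  have h1 : HasFDerivAt (blowup φ x) _ p := (hasFDerivAt_fst (𝕜 := ℝ) (p := p)).prodMk
    ((hs.contDiff_meanVelocity x).differentiable (by norm_num) p).hasFDerivAt
  rw [h1.fderiv] at h
  have ha : a = 0 := congrArg Prod.fst h
  subst ha
  rw [hs.fderiv_meanVelocity_injective x p.2 w p.1 (congrArg Prod.snd h)]
  rfl

theorem exists_blowup_homeomorph (x : E n) (p : ℝ × E n) :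
    ∃ e : OpenPartialHomeomorph (ℝ × E n) (ℝ × E n), (e : ℝ × E n → ℝ × E n) = blowup φ x ∧
      p ∈ e.source ∧ ContDiffAt ℝ 1 e.symm (blowup φ x p) :=
  exists_openPartialHomeomorph (hs.contDiff_blowup x) p (hs.fderiv_blowup_injective x p)

theorem isLocalHomeomorph_blowup (x : E n) : IsLocalHomeomorph (blowup φ x) := fun p => by
  obtain ⟨e, he, hp, -⟩ := hs.exists_blowup_homeomorph x p
  exact ⟨e, hp, he.symm⟩

theorem hasFDerivAt_orbitAction (x : E n) (p : ℝ × E n) :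
    HasFDerivAt (orbitAction L φ x) (fderiv ℝ (orbitAction L φ x) p) p :=
  ((hs.contDiff_orbitAction x).differentiable (by norm_num) p).hasFDerivAt

theorem fderiv_orbitAction_time (x v : E n) (t : ℝ) :
    fderiv ℝ (orbitAction L φ x) (t, v) (1, 0) = L (orbit φ x (t, v)) := by
  have h1 := (hs.hasFDerivAt_orbitAction x (t, v)).comp_hasDerivAt t
    ((hasDerivAt_id t).prodMk (hasDerivAt_const t v))
  have hc : Continuous fun s => L (orbit φ x (s, v)) :=
    hs.contDiff.continuous.comp (hs.continuous_orbit_time x v)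
  have h2 := (hc.integral_hasStrictDerivAt 0 t).hasDerivAt
  refine h1.unique ?_
  convert h2 using 1
  exact funext fun s => orbitAction_eq x v s

theorem hasDerivAt_partialV_orbit (x v : E n) (t : ℝ) :
    HasDerivAt (fun s => partialV n L (orbit φ x (s, v)).1 (orbit φ x (s, v)).2)
      (partialX n L (orbit φ x (t, v)).1 (orbit φ x (t, v)).2) t := by
  have h := (hs.extremal (x, v)).2 t
  simp only [← hs.flow_snd] at h
  exact h

/-- First variation of the action of the extremal curves issued from `x`. -/
theorem fderiv_orbitAction_velocity (x v w : E n) (t : ℝ) :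
    fderiv ℝ (orbitAction L φ x) (t, v) (0, w) =
      partialV n L (orbit φ x (t, v)).1 (orbit φ x (t, v)).2
        (fderiv ℝ (orbit φ x) (t, v) (0, w)).1 := by
  have hLd : Differentiable ℝ L := hs.contDiff.differentiable (by norm_num)
  have h1 : fderiv ℝ (orbitAction L φ x) (t, v) (0, w)
      = t • fderiv ℝ (meanAction L φ x) (t, v) (0, w) := by
    have h2 : HasFDerivAt (orbitAction L φ x) _ (t, v) := (hasFDerivAt_fst (𝕜 := ℝ)).mul
      ((contDiff_timeAverage (hs.contDiff_action x)).differentiable (by norm_num)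
        (t, v)).hasFDerivAt
    rw [h2.fderiv]
    simp [meanAction]
  rw [h1, meanAction, smul_fderiv_timeAverage (hs.contDiff_action x)]
  have h3 : ∀ s, HasDerivAt (fun s => partialV n L (orbit φ x (s, v)).1 (orbit φ x (s, v)).2
      (fderiv ℝ (orbit φ x) (s, v) (0, w)).1)
      (fderiv ℝ (fun p => L (orbit φ x p)) (s, v) (0, w)) s := by
    intro s
    have h4 := (hs.hasDerivAt_partialV_orbit x v s).clm_apply
      (hs.hasDerivAt_fderiv_orbit_fst x v w s)
    have h5 : fderiv ℝ (fun p => L (orbit φ x p)) (s, v) (0, w) =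
        fderiv ℝ L (orbit φ x (s, v)) (fderiv ℝ (orbit φ x) (s, v) (0, w)) := by
      have h6 : HasFDerivAt (fun p => L (orbit φ x p)) _ (s, v) :=
        (hLd _).hasFDerivAt.comp (s, v) (hs.hasFDerivAt_orbit x (s, v))
      rw [h6.fderiv]
      rfl
    rw [h5, ← Prod.mk.eta (p := fderiv ℝ (orbit φ x) (s, v) (0, w)),
      ← Prod.mk.eta (p := orbit φ x (s, v)), fderiv_eq_partial hLd]
    exact h4
  have hc : Continuous fun s => fderiv ℝ (fun p => L (orbit φ x p)) (s, v) (0, w) :=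
    (((hs.contDiff_action x).continuous_fderiv (by norm_num)).comp
      (Continuous.prodMk_left v)).clm_apply continuous_const
  rw [intervalIntegral.integral_eq_sub_of_hasDerivAt (fun s _ => h3 s)
    (hc.intervalIntegrable _ _)]
  have h6 : fderiv ℝ (orbit φ x) (0, v) (0, w) = (0, w) := by
    have h7 := (hs.hasFDerivAt_orbit x (0, v)).comp v (hasFDerivAt_prodMk_right (0:ℝ) v)
    have h8 : (orbit φ x ∘ fun v => ((0:ℝ), v)) = fun v => (x, v) :=
      funext fun v => hs.flow_zero (x, v)
    rw [h8] at h7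
    simpa using congrArg (fun f => f w) (h7.unique (hasFDerivAt_prodMk_right x v))
  rw [h6]
  simp

/-- A curve has at least the rate of action of the field of extremals it crosses. -/
theorem exists_hasDerivAt_orbitAction_le (x : E n) {u σ : ℝ → E n} {u' σ' : E n} {t : ℝ}
    (hu : HasDerivAt u u' t) (hσ : HasDerivAt σ σ' t)
    (he : ∀ᶠ s in nhds t, (orbit φ x (s, u s)).1 = σ s) :
    ∃ D, HasDerivAt (fun s => orbitAction L φ x (s, u s)) D t ∧ D ≤ L (σ t, σ') := by
  have hsu : HasDerivAt (fun s => (s, u s)) (1, u') t := (hasDerivAt_id t).prodMk hu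
  have hsplit : ((1, u') : ℝ × E n) = (1, 0) + (0, u') := by simp
  have h0 := (hs.hasFDerivAt_orbitAction x (t, u t)).comp_hasDerivAt t hsu
  refine ⟨fderiv ℝ (orbitAction L φ x) (t, u t) (1, u'), h0, ?_⟩
  have h1 := (hs.hasFDerivAt_orbit x (t, u t)).fst.comp_hasDerivAt t hsu
  have h2 := h1.unique (hσ.congr_of_eventuallyEq he)
  have h3 : (fderiv ℝ (orbit φ x) (t, u t) (1, 0)).1 = (orbit φ x (t, u t)).2 := by
    have h4 := (hs.hasFDerivAt_orbit x (t, u t)).fst.comp_hasDerivAt t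
      ((hasDerivAt_id t).prodMk (hasDerivAt_const t (u t)))
    exact h4.unique (hs.hasDerivAt_orbit_fst x (u t) t)
  have h5 : (fderiv ℝ (orbit φ x) (t, u t) (0, u')).1 = σ' - (orbit φ x (t, u t)).2 := by
    rw [← h2, ← h3, ContinuousLinearMap.comp_apply, ContinuousLinearMap.coe_fst',
      ← Prod.fst_sub, ← map_sub]
    simp
  rw [hsplit, map_add, hs.fderiv_orbitAction_time, hs.fderiv_orbitAction_velocity, h5,
    ← he.self_of_nhds]
  exact add_partialV_le hs.contDiff hs.posDef _ _ _

end ConjugateFree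

section PathLifting

variable {X Y : Type*} [TopologicalSpace X] [FirstCountableTopology X] [TopologicalSpace Y]
  [T2Space Y]

/-- The curve `Γ` lifts `γ` through `f` on `[a, s]`, starting from `z`. -/
structure IsLiftOn (f : X → Y) (γ : ℝ → Y) (z : X) (a s : ℝ) (Γ : ℝ → X) : Prop where
  continuousOn : ContinuousOn Γ (Set.Icc a s)
  start : Γ a = z
  lifts : ∀ t ∈ Set.Icc a s, f (Γ t) = γ t

omit [FirstCountableTopology X] [T2Space Y] in
theorem IsLiftOn.extend {f : X → Y} {γ : ℝ → Y} {z : X} {a b r r' : ℝ} {Γ : ℝ → X}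
    (hΓ : IsLiftOn f γ z a r Γ) (hγ : ContinuousOn γ (Set.Icc a b)) (har : a ≤ r)
    (hrb : r' ≤ b) (e : OpenPartialHomeomorph X Y) (he : (e : X → Y) = f) (hr : Γ r ∈ e.source)
    (ht : ∀ t ∈ Set.Icc r r', γ t ∈ e.target) :
    ∃ Γ' : ℝ → X, IsLiftOn f γ z a r' Γ' := by
  classical
  have hval : e.symm (γ r) = Γ r := by
    rw [← hΓ.lifts r ⟨har, le_rfl⟩, ← he, e.left_inv hr]
  refine ⟨fun t => if t ≤ r then Γ t else e.symm (γ t), ?_, ?_, ?_⟩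
  · refine ContinuousOn.if ?_ ?_ ?_
    · rintro t ⟨-, h⟩
      have : t = r := by
        have : t ∈ frontier (Set.Iic r) := h
        simpa using this
      rw [this, hval]
    · refine hΓ.continuousOn.mono ?_
      rintro t ⟨h1, h2⟩
      have h3 : t ∈ closure (Set.Iic r) := h2
      exact ⟨h1.1, by simpa using h3⟩
    · have hsub : Set.Icc r r' ⊆ Set.Icc a b := Set.Icc_subset_Icc har hrb
      refine (e.continuousOn_symm.comp (hγ.mono hsub) ht).mono ?_
      rintro t ⟨h1, h2⟩
      have h3 : t ∈ closure (Set.Ioi r) := by simpa [Set.Ioi] using h2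
      exact ⟨by simpa using h3, h1.2⟩
  · simp [har, hΓ.start]
  · intro t h
    by_cases htr : t ≤ r
    · simp [htr, hΓ.lifts t ⟨h.1, htr⟩]
    · simp only [htr, if_false]
      rw [← he, e.right_inv (ht t ⟨(not_le.1 htr).le, h.2⟩)]

/-- Paths lift through a local homeomorphism provided partial lifts stay in a compact set. -/
theorem IsLocalHomeomorph.exists_isLiftOn {f : X → Y} (hf : IsLocalHomeomorph f) {γ : ℝ → Y}
    {a b : ℝ} (hab : a ≤ b) (hγ : ContinuousOn γ (Set.Icc a b)) {z : X} (hz : f z = γ a)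
    {K : Set X} (hK : IsCompact K)
    (hb : ∀ s ∈ Set.Icc a b, ∀ Γ, IsLiftOn f γ z a s Γ → Γ s ∈ K) :
    ∃ Γ, IsLiftOn f γ z a b Γ := by
  set J : Set ℝ := {s | ∃ Γ, IsLiftOn f γ z a s Γ}
  have hext : ∀ s ∈ Set.Icc a b, ∀ y, f y = γ s → ∃ W ∈ nhds y, ∃ δ > 0, ∀ r ∈ Set.Icc a b,
      ∀ Γ, IsLiftOn f γ z a r Γ → |r - s| < δ → Γ r ∈ W →
      ∀ r' ∈ Set.Icc a b, |r' - s| < δ → r' ∈ J := by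
    intro s hs y hy
    obtain ⟨e, hye, he⟩ := hf y
    have h1 : ∀ᶠ t in nhdsWithin s (Set.Icc a b), γ t ∈ e.target :=
      (hγ s hs).eventually_mem (e.open_target.mem_nhds (by
        rw [← hy, he]; exact e.map_source hye))
    obtain ⟨δ, hδ, h2⟩ := Metric.eventually_nhds_iff.1 (eventually_nhdsWithin_iff.1 h1)
    refine ⟨e.source, e.open_source.mem_nhds hye, δ, hδ, ?_⟩
    intro r hr Γ hΓ hrs hrW r' hr' hrs'
    refine hΓ.extend hγ hr.1 hr'.2 e he.symm hrW fun t ht => ?_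
    refine h2 ?_ ⟨hr.1.trans ht.1, ht.2.trans hr'.2⟩
    rw [abs_lt] at hrs hrs'
    rw [Real.dist_eq, abs_lt]
    exact ⟨by linarith [ht.1], by linarith [ht.2]⟩
  have hsub : Set.Icc a b ⊆ J := by
    refine IsClosed.Icc_subset_of_forall_exists_gt ?_ ?_ ?_
    · refine isClosed_of_closure_subset fun s hs => ?_
      have hsI : s ∈ Set.Icc a b :=
        closure_minimal Set.inter_subset_right isClosed_Icc hs
      obtain ⟨r, hr, hrs⟩ := mem_closure_iff_seq_limit.1 hs
      choose Γ hΓ using fun j => (hr j).1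
      obtain ⟨y, -, θ, hθ, hy⟩ := hK.tendsto_subseq fun j => hb _ (hr j).2 _ (hΓ j)
      have hrθ := hrs.comp hθ.tendsto_atTop
      have hys : f y = γ s := by
        refine tendsto_nhds_unique ((hf.continuous.tendsto y).comp hy) ?_
        have h1 := (hγ s hsI).tendsto.comp
          (tendsto_nhdsWithin_iff.2 ⟨hrθ, Filter.Eventually.of_forall fun j => (hr _).2⟩)
        refine h1.congr fun j => ?_
        exact ((hΓ _).lifts _ ⟨(hr _).2.1, le_rfl⟩).symm
      obtain ⟨W, hW, δ, hδ, h⟩ := hext s hsI y hys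
      have h1 : ∀ᶠ j in Filter.atTop, |(r ∘ θ) j - s| < δ := by
        simpa [Real.dist_eq] using hrθ (Metric.ball_mem_nhds s hδ)
      obtain ⟨j, hj, hjW⟩ := (h1.and (hy hW)).exists
      exact ⟨h _ (hr _).2 _ (hΓ _) hj hjW s hsI (by simpa using hδ), hsI⟩
    · refine ⟨fun _ => z, continuousOn_const, rfl, fun t ht => ?_⟩
      rw [le_antisymm ht.2 ht.1, hz]
    · rintro s ⟨⟨Γ, hΓ⟩, hs⟩ y hy
      have hsI : s ∈ Set.Icc a b := ⟨hs.1, hs.2.le⟩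
      obtain ⟨W, hW, δ, hδ, h⟩ := hext s hsI (Γ s) (hΓ.lifts s ⟨hs.1, le_rfl⟩)
      have hm : 0 < min (δ / 2) (min (y - s) (b - s)) :=
        lt_min (by linarith) (lt_min (sub_pos.2 hy) (sub_pos.2 hs.2))
      set m := min (δ / 2) (min (y - s) (b - s))
      have hm1 : m ≤ δ / 2 := min_le_left _ _
      have hm2 : m ≤ y - s := (min_le_right _ _).trans (min_le_left _ _)
      have hm3 : m ≤ b - s := (min_le_right _ _).trans (min_le_right _ _)
      refine ⟨s + m, h s hsI Γ hΓ (by simpa using hδ) (mem_of_mem_nhds hW) _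
        ⟨by linarith [hs.1], by linarith⟩ ?_, by linarith, by linarith⟩
      rw [add_sub_cancel_left, abs_of_pos hm]
      linarith
  exact hsub ⟨hab, le_rfl⟩

end PathLifting

namespace ConjugateFree

variable {n : ℕ} {L : E n × E n → ℝ} {φ : ℝ → E n × E n → E n × E n} (hs : ConjugateFree n L φ)

include hs

theorem exists_velocity_bound_of_meanAction_le (C T : ℝ) :
    ∃ R, ∀ x v : E n, ∀ t ∈ Set.Icc 0 T, meanAction L φ x (t, v) ≤ C → ‖v‖ ≤ R := by
  obtain ⟨R₀, hR₀⟩ := hs.superlinear 1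
  obtain ⟨R, hR⟩ := hs.exists_velocity_bound (max R₀ C) T
  refine ⟨R, fun x v t ht hC => ?_⟩
  have hc : Continuous fun u : ℝ => L (orbit φ x (u * t, v)) :=
    hs.contDiff.continuous.comp ((hs.continuous_orbit_time x v).comp (continuous_mul_const t))
  obtain ⟨u, hu, huC⟩ : ∃ u ∈ Set.Icc (0:ℝ) 1, L (orbit φ x (u * t, v)) ≤ C := by
    by_contra! h
    have h1 := intervalIntegral.intervalIntegral_pos_of_pos_on
      ((hc.sub (continuous_const (y := C))).intervalIntegrable (μ := volume) 0 1)
      (fun u hu => sub_pos.2 (h u (Set.Ioo_subset_Icc_self hu))) one_pos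
    simp only [Pi.sub_apply] at h1
    rw [intervalIntegral.integral_sub (hc.intervalIntegrable _ _) (by simp)] at h1
    simp only [intervalIntegral.integral_const, sub_zero, one_smul] at h1
    exact (sub_pos.1 h1).not_ge hC
  refine hR (u * t) ⟨mul_nonneg hu.1 ht.1, ?_⟩ (x, v) ?_
  · nlinarith [hu.2, ht.1, ht.2]
  · by_contra! h
    have h1 := hR₀ (orbit φ x (u * t, v)).1 _ ((le_max_left _ _).trans h.le)
    have h2 := (le_max_right R₀ C).trans_lt h
    rw [one_mul] at h1
    exact (h1.trans huC).not_gt h2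

theorem continuous_action_of_contDiff {σ : ℝ → E n} (hσ : ContDiff ℝ 1 σ) :
    Continuous fun s => L (σ s, deriv σ s) :=
  hs.contDiff.continuous.comp (hσ.continuous.prodMk (hσ.continuous_deriv le_rfl))

/-- A curve has at least the action of the field of extremals it crosses. -/
theorem orbitAction_le_add_integral (x : E n) {t₀ t₁ : ℝ} (h₀ : 0 ≤ t₀) (h₁ : t₀ ≤ t₁)
    {σ u : ℝ → E n} (hσ : ContDiff ℝ 1 σ) (hu : ContinuousOn u (Set.Icc t₀ t₁))
    (hl : ∀ t ∈ Set.Icc t₀ t₁, (orbit φ x (t, u t)).1 = σ t) :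
    orbitAction L φ x (t₁, u t₁) ≤
      orbitAction L φ x (t₀, u t₀) + ∫ s in t₀..t₁, L (σ s, deriv σ s) := by
  have hc := hs.continuous_action_of_contDiff hσ
  have hd : ∀ t ∈ Set.Ioo t₀ t₁, ∃ D, 0 ≤ D ∧ HasDerivAt (fun t =>
      (∫ s in t₀..t, L (σ s, deriv σ s)) - orbitAction L φ x (t, u t)) D t := by
    intro t ht
    have ht0 : 0 < t := h₀.trans_lt ht.1
    have hI : ∀ᶠ s in nhds t, s ∈ Set.Icc t₀ t₁ := Icc_mem_nhds ht.1 ht.2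
    obtain ⟨e, he, hes, hed⟩ := hs.exists_blowup_homeomorph x (t, u t)
    have hmean : ∀ s ∈ Set.Icc t₀ t₁, 0 < s →
        blowup φ x (s, u s) = (s, s⁻¹ • (σ s - x)) := fun s hs' h0 => by
      rw [← hl s hs', ← hs.add_smul_meanVelocity, add_sub_cancel_left, smul_smul,
        inv_mul_cancel₀ h0.ne', one_smul]
      rfl
    have hut : HasDerivAt u (deriv u t) t := by
      have huc : ContinuousAt (fun s => (s, u s)) t :=
        continuousAt_id.prodMk (hu.continuousAt (Icc_mem_nhds ht.1 ht.2))
      have h1 : ∀ᶠ s in nhds t, (s, u s) ∈ e.source := huc (e.open_source.mem_nhds hes)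
      have h2 : u =ᶠ[nhds t] fun s => (e.symm (s, s⁻¹ • (σ s - x))).2 := by
        filter_upwards [h1, hI, lt_mem_nhds ht0] with s hse hsI hs0
        rw [← hmean s hsI hs0, ← he, e.left_inv hse]
      rw [hmean t hI.self_of_nhds ht0] at hed
      have h3 : DifferentiableAt ℝ (fun s : ℝ => (s, s⁻¹ • (σ s - x))) t :=
        differentiableAt_id.prodMk ((differentiableAt_inv ht0.ne').smul
          ((hσ.differentiable (by norm_num) t).sub_const x))
      have h4 : DifferentiableAt ℝ (fun s => e.symm (s, s⁻¹ • (σ s - x))) t :=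
        (hed.differentiableAt (by norm_num)).comp t h3
      exact (h4.snd.congr_of_eventuallyEq h2).hasDerivAt
    have hσt := (hσ.differentiable (by norm_num) t).hasDerivAt
    obtain ⟨D, hD, hDle⟩ := hs.exists_hasDerivAt_orbitAction_le x hut hσt
      (hI.mono fun s hs' => hl s hs')
    exact ⟨_, sub_nonneg.2 hDle,
      ((hc.integral_hasStrictDerivAt t₀ t).hasDerivAt).sub hD⟩
  have hcont : ContinuousOn (fun t =>
      (∫ s in t₀..t, L (σ s, deriv σ s)) - orbitAction L φ x (t, u t)) (Set.Icc t₀ t₁) :=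
    (intervalIntegral.continuous_primitive (fun a b => hc.intervalIntegrable a b) _).continuousOn.sub
      ((hs.contDiff_orbitAction x).continuous.comp_continuousOn (continuousOn_id.prodMk hu))
  have hm := monotoneOn_of_deriv_nonneg (convex_Icc t₀ t₁) hcont
    (fun t ht => by
      rw [interior_Icc] at ht
      obtain ⟨D, -, h⟩ := hd t ht
      exact h.differentiableAt.differentiableWithinAt)
    (fun t ht => by
      rw [interior_Icc] at ht
      obtain ⟨D, hD, h⟩ := hd t ht
      rwa [h.deriv])
    ⟨le_rfl, h₁⟩ ⟨h₁, le_rfl⟩ h₁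
  simp only [intervalIntegral.integral_same] at hm
  linarith

/-- Curves issued from `x` lift to the space of extremal curves issued from `x`. -/
theorem exists_lift (x : E n) {t₀ t₁ : ℝ} (h₀ : 0 ≤ t₀) (h₁ : t₀ ≤ t₁) {σ g : ℝ → E n}
    (hσ : ContDiff ℝ 1 σ) (hg : ContinuousOn g (Set.Icc t₀ t₁))
    (hσg : ∀ t ∈ Set.Icc t₀ t₁, σ t = x + t • g t) {v₀ : E n}
    (hv₀ : meanVelocity φ x (t₀, v₀) = g t₀) :
    ∃ u : ℝ → E n, ContinuousOn u (Set.Icc t₀ t₁) ∧ u t₀ = v₀ ∧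
      ∀ t ∈ Set.Icc t₀ t₁, meanVelocity φ x (t, u t) = g t := by
  have hc := hs.continuous_action_of_contDiff hσ
  obtain ⟨M, hM⟩ := (isCompact_Icc (a := t₀) (b := t₁)).exists_bound_of_continuousOn hc.continuousOn
  obtain ⟨R, hR⟩ := hs.exists_velocity_bound_of_meanAction_le
    (max (meanAction L φ x (t₀, v₀)) M) t₁
  have key : ∀ s ∈ Set.Icc t₀ t₁, ∀ Γ : ℝ → ℝ × E n,
      IsLiftOn (blowup φ x) (fun t => (t, g t)) (t₀, v₀) t₀ s Γ →
      ∀ t ∈ Set.Icc t₀ s, Γ t = (t, (Γ t).2) ∧ meanVelocity φ x (t, (Γ t).2) = g t := by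
    intro s hs' Γ hΓ t ht
    have h1 := hΓ.lifts t ht
    have h2 : Γ t = (t, (Γ t).2) := Prod.ext (congrArg Prod.fst h1 :) rfl
    refine ⟨h2, ?_⟩
    rw [← h2]
    exact congrArg Prod.snd h1
  obtain ⟨Γ, hΓ⟩ := IsLocalHomeomorph.exists_isLiftOn (hs.isLocalHomeomorph_blowup x) h₁
    (γ := fun t => (t, g t)) (continuousOn_id.prodMk hg) (z := (t₀, v₀))
    (by rw [blowup, hv₀]) (K := Set.Icc t₀ t₁ ×ˢ Metric.closedBall 0 R)
    (isCompact_Icc.prod (isCompact_closedBall _ _)) (by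
      intro s hs' Γ hΓ
      obtain ⟨h1, -⟩ := key s hs' Γ hΓ s ⟨hs'.1, le_rfl⟩
      refine ⟨by rw [h1]; exact hs', ?_⟩
      rw [mem_closedBall_zero_iff]
      refine hR x _ s ⟨h₀.trans hs'.1, hs'.2⟩ ?_
      rcases hs'.1.eq_or_lt with rfl | hlt
      · rw [hΓ.start]
        exact le_max_left _ _
      have hs0 : 0 < s := h₀.trans_lt hlt
      have h2 := hs.orbitAction_le_add_integral x h₀ hs'.1 hσ (u := fun t => (Γ t).2)
        hΓ.continuousOn.snd (fun t ht => by
          rw [← hs.add_smul_meanVelocity, (key s hs' Γ hΓ t ht).2,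
            hσg t ⟨ht.1, ht.2.trans hs'.2⟩])
      have h3 : (∫ t in t₀..s, L (σ t, deriv σ t)) ≤ ∫ t in t₀..s, M :=
        intervalIntegral.integral_mono_on hs'.1 (hc.intervalIntegrable _ _) (by simp)
          fun t ht => (le_abs_self _).trans (hM t ⟨ht.1, ht.2.trans hs'.2⟩)
      rw [intervalIntegral.integral_const, smul_eq_mul] at h3
      have h4 : (Γ t₀).2 = v₀ := by rw [hΓ.start]
      simp only [h4, orbitAction] at h2
      have h5 := le_max_left (meanAction L φ x (t₀, v₀)) M
      have h6 := le_max_right (meanAction L φ x (t₀, v₀)) M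
      have h7 := mul_le_mul_of_nonneg_left h5 h₀
      have h8 := mul_le_mul_of_nonneg_left h6 (sub_nonneg.2 hs'.1)
      refine le_of_mul_le_mul_left ?_ hs0
      linarith)
  exact ⟨fun t => (Γ t).2, hΓ.continuousOn.snd, by simp only [hΓ.start],
    fun t ht => (key t₁ ⟨h₁, le_rfl⟩ Γ hΓ t ht).2⟩

end ConjugateFree

namespace ConjugateFree

variable {n : ℕ} {L : E n × E n → ℝ} {φ : ℝ → E n × E n → E n × E n} (hs : ConjugateFree n L φ)

include hs

theorem contDiff_orbit_fst (x v : E n) : ContDiff ℝ 1 fun t => (orbit φ x (t, v)).1 :=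
  (hs.extremal (x, v)).1.of_le (by norm_num)

theorem continuous_meanVelocity_time (x v : E n) :
    Continuous fun t => meanVelocity φ x (t, v) :=
  (hs.contDiff_meanVelocity x).continuous.comp (Continuous.prodMk_left v)

theorem lift_eq_const (x v : E n) {T : ℝ} (hT : 0 ≤ T) {u : ℝ → E n}
    (hu : ContinuousOn u (Set.Icc 0 T)) (h0 : u 0 = v)
    (hl : ∀ t ∈ Set.Icc 0 T, meanVelocity φ x (t, u t) = meanVelocity φ x (t, v)) : u T = v := by
  have h := (T2Space.isSeparatedMap (blowup φ x)).eqOn_of_comp_eqOn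
    (hs.isLocalHomeomorph_blowup x).isLocallyInjective (isPreconnected_Icc (a := 0) (b := T))
    (g₁ := fun t => (t, u t)) (g₂ := fun t => (t, v)) (continuousOn_id.prodMk hu)
    (continuousOn_id.prodMk continuousOn_const)
    (fun t ht => by simp [blowup, hl t ht]) ⟨le_rfl, hT⟩ (by simp [h0])
  exact (congrArg Prod.snd (h ⟨hT, le_rfl⟩) :)

/-- There is at most one extremal curve joining two points in a given time. -/
theorem orbit_fst_injective (x : E n) {T : ℝ} (hT : 0 < T) {v w : E n}
    (h : (orbit φ x (T, v)).1 = (orbit φ x (T, w)).1) : v = w := by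
  have hmean : meanVelocity φ x (T, v) = meanVelocity φ x (T, w) := by
    rw [← hs.add_smul_meanVelocity, ← hs.add_smul_meanVelocity] at h
    exact smul_right_injective _ hT.ne' (add_left_cancel h)
  have hlift : ∀ τ : ℝ, ∃ u : ℝ → E n, ContinuousOn u (Set.Icc 0 T) ∧
      u 0 = (1 - τ) • v + τ • w ∧ ∀ t ∈ Set.Icc 0 T, meanVelocity φ x (t, u t) =
        (1 - τ) • meanVelocity φ x (t, v) + τ • meanVelocity φ x (t, w) := fun τ => by
    refine hs.exists_lift x le_rfl hT.le
      (σ := fun t => (1 - τ) • (orbit φ x (t, v)).1 + τ • (orbit φ x (t, w)).1)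
      (g := fun t => (1 - τ) • meanVelocity φ x (t, v) + τ • meanVelocity φ x (t, w))
      (((hs.contDiff_orbit_fst x v).const_smul _).add ((hs.contDiff_orbit_fst x w).const_smul _))
      (((hs.continuous_meanVelocity_time x v).const_smul (1 - τ)).add
        ((hs.continuous_meanVelocity_time x w).const_smul τ)).continuousOn (fun t _ => ?_)
      (by simp only [hs.meanVelocity_zero])
    simp only [← hs.add_smul_meanVelocity]
    module
  choose u hu hu0 hul using hlift
  have hmem : ∀ s : unitInterval, (s : ℝ) * T ∈ Set.Icc 0 T := fun s =>
    ⟨mul_nonneg s.2.1 hT.le, mul_le_of_le_one_left hT.le s.2.2⟩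
  have hst : Continuous fun p : unitInterval × ℝ => (p.1 : ℝ) * T :=
    (continuous_subtype_val.comp continuous_fst).mul continuous_const
  have hcont := (hs.isLocalHomeomorph_blowup x).continuous_lift (T2Space.isSeparatedMap _)
    (f := ⟨fun p : unitInterval × ℝ => ((p.1 : ℝ) * T,
        (1 - p.2) • meanVelocity φ x ((p.1 : ℝ) * T, v)
          + p.2 • meanVelocity φ x ((p.1 : ℝ) * T, w)),
      hst.prodMk (((continuous_const.sub continuous_snd).smul
        ((hs.continuous_meanVelocity_time x v).comp hst)).add
        (continuous_snd.smul ((hs.continuous_meanVelocity_time x w).comp hst)))⟩)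
    (g := fun p => ((p.1 : ℝ) * T, u p.2 ((p.1 : ℝ) * T)))
    (funext fun p => Prod.ext rfl (hul p.2 _ (hmem p.1)))
    (by
      simp only [Set.Icc.coe_zero, zero_mul, hu0]
      fun_prop)
    (fun τ => (continuous_subtype_val.mul continuous_const).prodMk
      ((hu τ).comp_continuous (continuous_subtype_val.mul continuous_const) hmem))
  have hconst := (T2Space.isSeparatedMap (blowup φ x)).const_of_comp
    (hs.isLocalHomeomorph_blowup x).isLocallyInjective
    (hcont.comp (Continuous.prodMk_right (1 : unitInterval)))
    (fun τ τ' => by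
      simp only [Function.comp_apply, Set.Icc.coe_one, one_mul, blowup,
        hul _ T ⟨hT.le, le_rfl⟩, hmean]
      congr 1
      module) 0 1
  have h01 : u 0 T = u 1 T := by
    simpa using congrArg Prod.snd hconst
  have hv := hs.lift_eq_const x v hT.le (hu 0) (by simp [hu0]) (fun t ht => by simp [hul 0 t ht])
  have hw := hs.lift_eq_const x w hT.le (hu 1) (by simp [hu0]) (fun t ht => by simp [hul 1 t ht])
  rw [← hv, ← hw, h01]

end ConjugateFree

/-- The action of the extremal curve joining `x` to `y` in time `t`. -/
def connectingAction {n : ℕ} (L : E n × E n → ℝ) (φ : ℝ → E n × E n → E n × E n) (t : ℝ)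
    (x y : E n) : ℝ :=
  orbitAction L φ x (t, Function.invFun (fun v => (orbit φ x (t, v)).1) y)

namespace ConjugateFree

variable {n : ℕ} {L : E n × E n → ℝ} {φ : ℝ → E n × E n → E n × E n} (hs : ConjugateFree n L φ)

include hs

theorem exists_orbit_fst_eq (x y : E n) {t : ℝ} (ht : 0 < t) :
    ∃ v, (orbit φ x (t, v)).1 = y := by
  obtain ⟨u, -, -, hu⟩ := hs.exists_lift x le_rfl ht.le (σ := fun s => x + s • t⁻¹ • (y - x))
    (g := fun _ => t⁻¹ • (y - x)) (contDiff_const.add (contDiff_id.smul contDiff_const))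
    continuousOn_const (fun _ _ => rfl) (hs.meanVelocity_zero x _)
  refine ⟨u t, ?_⟩
  rw [← hs.add_smul_meanVelocity, hu t ⟨ht.le, le_rfl⟩, smul_smul, mul_inv_cancel₀ ht.ne',
    one_smul, add_sub_cancel]

theorem connectingAction_orbit (x v : E n) {t : ℝ} (ht : 0 < t) :
    connectingAction L φ t x (orbit φ x (t, v)).1 = orbitAction L φ x (t, v) := by
  have h : Function.Injective fun v => (orbit φ x (t, v)).1 :=
    fun _ _ h => hs.orbit_fst_injective x ht h
  rw [connectingAction, Function.leftInverse_invFun h v]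

theorem orbit_eq {c : ℝ → E n} (hc : IsExtremal n L c) (a t : ℝ) :
    orbit φ (c a) (t, deriv c a) = (c (t + a), deriv c (t + a)) := by
  have h := hs.flow_eq (hc.comp_add_const a) t
  rw [deriv_comp_add_const, deriv_comp_add_const, zero_add] at h
  exact h

theorem connectingAction_extremal {c : ℝ → E n} (hc : IsExtremal n L c) {a b : ℝ} (hab : a < b) :
    connectingAction L φ (b - a) (c a) (c b) = ∫ s in a..b, L (c s, deriv c s) := by
  have h := hs.connectingAction_orbit (c a) (deriv c a) (sub_pos.2 hab)
  simp only [orbitAction_eq, hs.orbit_eq hc, sub_add_cancel] at h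
  rw [h, intervalIntegral.integral_comp_add_right (fun s => L (c s, deriv c s))]
  simp

theorem connectingAction_le_integral {σ : ℝ → E n} (hσ : ContDiff ℝ 1 σ) {a b : ℝ} (hab : a < b) :
    connectingAction L φ (b - a) (σ a) (σ b) ≤ ∫ s in a..b, L (σ s, deriv σ s) := by
  have hσ' : ContDiff ℝ 1 fun s => σ (s + a) := hσ.comp (contDiff_id.add contDiff_const)
  have h0 : 0 < b - a := sub_pos.2 hab
  have hg : ContinuousOn (dslope (fun s => σ (s + a)) 0) (Set.Icc 0 (b - a)) :=
    ((continuousOn_dslope (s := Set.univ) Filter.univ_mem).2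
      ⟨hσ'.continuous.continuousOn, hσ'.differentiable (by norm_num) 0⟩).mono (Set.subset_univ _)
  have hσg : ∀ t, σ (t + a) = σ a + t • dslope (fun s => σ (s + a)) 0 t := fun t => by
    have := sub_smul_dslope (fun s => σ (s + a)) 0 t
    rw [sub_zero, zero_add] at this
    rw [this, add_sub_cancel]
  obtain ⟨u, hu, -, hul⟩ := hs.exists_lift (σ a) le_rfl h0.le hσ' hg (fun t _ => hσg t)
    (hs.meanVelocity_zero _ _)
  have hend : ∀ t ∈ Set.Icc 0 (b - a), (orbit φ (σ a) (t, u t)).1 = σ (t + a) := fun t ht => by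
    rw [← hs.add_smul_meanVelocity, hul t ht, hσg]
  have h1 := hs.orbitAction_le_add_integral (σ a) le_rfl h0.le hσ' hu hend
  rw [← hs.connectingAction_orbit _ _ h0, hend _ ⟨h0.le, le_rfl⟩] at h1
  simp only [deriv_comp_add_const, sub_add_cancel, orbitAction_eq,
    intervalIntegral.integral_same, zero_add] at h1
  rw [intervalIntegral.integral_comp_add_right (fun s => L (σ s, deriv σ s))] at h1
  simpa using h1

theorem connectingAction_add_le (x y z : E n) {t s : ℝ} (ht : 0 < t) (hs' : 0 < s) :
    connectingAction L φ (t + s) x z ≤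
      connectingAction L φ t x y + connectingAction L φ s y z := by
  obtain ⟨v, rfl⟩ := hs.exists_orbit_fst_eq x y ht
  set y := (orbit φ x (t, v)).1 with hy
  obtain ⟨w, rfl⟩ := hs.exists_orbit_fst_eq y z hs'
  rw [hs.connectingAction_orbit x v ht, hs.connectingAction_orbit y w hs']
  have hσ : ContDiff ℝ 1 fun r => (orbit φ y (r - t, w)).1 :=
    (hs.contDiff_orbit_fst y w).comp (contDiff_id.sub contDiff_const)
  have hpos : ∀ r ∈ Set.Icc t (t + s), r ≠ 0 := fun r hr => (ht.trans_le hr.1).ne'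
  have hy0 : (orbit φ y (t - t, w)).1 = y := by simp [orbit, hs.flow_zero]
  obtain ⟨u, hu, hut, hul⟩ := hs.exists_lift x ht.le (le_add_of_nonneg_right hs'.le) hσ
    (g := fun r => r⁻¹ • ((orbit φ y (r - t, w)).1 - x)) (v₀ := v)
    ((continuousOn_inv₀.mono hpos).smul (hσ.continuous.sub continuous_const).continuousOn)
    (fun r hr => by rw [smul_smul, mul_inv_cancel₀ (hpos r hr), one_smul, add_sub_cancel])
    (by
      simp only [hy0]
      rw [hy, ← hs.add_smul_meanVelocity, add_sub_cancel_left, smul_smul,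
        inv_mul_cancel₀ ht.ne', one_smul])
  have hend : ∀ r ∈ Set.Icc t (t + s), (orbit φ x (r, u r)).1 = (orbit φ y (r - t, w)).1 :=
    fun r hr => by
      rw [← hs.add_smul_meanVelocity, hul r hr, smul_smul, mul_inv_cancel₀ (hpos r hr), one_smul,
        add_sub_cancel]
  have h1 := hs.orbitAction_le_add_integral x ht.le (le_add_of_nonneg_right hs'.le) hσ hu hend
  rw [hut, ← hs.connectingAction_orbit x (u (t + s)) (add_pos ht hs'),
    hend _ ⟨le_add_of_nonneg_right hs'.le, le_rfl⟩, add_sub_cancel_left] at h1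
  refine h1.trans_eq ?_
  have hd : ∀ r, deriv (fun r => (orbit φ y (r - t, w)).1) r = (orbit φ y (r - t, w)).2 :=
    fun r => ((hs.hasDerivAt_orbit_fst y w (r - t)).comp_sub_const r t).deriv
  simp only [hd, Prod.mk.eta]
  rw [orbitAction_eq y, intervalIntegral.integral_comp_sub_right (fun r => L (orbit φ y (r, w)))]
  simp

theorem connectingAction_add_intVec (x y : E n) (m : Fin n → ℤ) {t : ℝ} (ht : 0 < t) :
    connectingAction L φ t (x + intVec m) (y + intVec m) = connectingAction L φ t x y := by
  obtain ⟨v, rfl⟩ := hs.exists_orbit_fst_eq x y ht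
  have h : ∀ s, orbit φ (x + intVec m) (s, v) =
      ((orbit φ x (s, v)).1 + intVec m, (orbit φ x (s, v)).2) :=
    fun s => hs.flow_add_intVec s x v m
  have h1 := hs.connectingAction_orbit (x + intVec m) v ht
  rw [hs.connectingAction_orbit x v ht, orbitAction_eq]
  simpa only [orbitAction_eq, h, hs.periodic] using h1

theorem exists_isMax_connectingAction {T : ℝ} (hT : 0 < T) :
    ∃ x, ∀ y, connectingAction L φ T y y ≤ connectingAction L φ T x x := by
  have husc : UpperSemicontinuous fun x => connectingAction L φ T x x := by
    intro x b hb
    obtain ⟨v, hv⟩ := hs.exists_orbit_fst_eq x x hT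
    have hσ := hs.contDiff_orbit_fst x v
    have hle : ∀ h, connectingAction L φ T (x + h) (x + h) ≤
        ∫ s in (0:ℝ)..T, L ((orbit φ x (s, v)).1 + h, (orbit φ x (s, v)).2) := fun h => by
      have h1 := hs.connectingAction_le_integral (hσ.add (contDiff_const (c := h))) hT
      simp only [deriv_add_const, (hs.hasDerivAt_orbit_fst x v _).deriv, sub_zero, hv] at h1
      simpa [orbit, hs.flow_zero] using h1
    have h0 : connectingAction L φ T x x = ∫ s in (0:ℝ)..T, L (orbit φ x (s, v)) := by
      have := hs.connectingAction_orbit x v hT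
      rwa [hv, orbitAction_eq] at this
    have hc : Continuous fun h => ∫ s in (0:ℝ)..T,
        L ((orbit φ x (s, v)).1 + h, (orbit φ x (s, v)).2) := by
      refine intervalIntegral.continuous_parametric_intervalIntegral_of_continuous' ?_ 0 T
      have h2 := (hs.continuous_orbit_time x v).comp (continuous_snd (X := E n) (Y := ℝ))
      exact hs.contDiff.continuous.comp ((h2.fst.add continuous_fst).prodMk h2.snd)
    have h1 : ∀ᶠ y in nhds x, ∫ s in (0:ℝ)..T,
        L ((orbit φ x (s, v)).1 + (y - x), (orbit φ x (s, v)).2) < b := by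
      refine (hc.comp (continuous_id.sub continuous_const)).continuousAt.eventually_lt
        continuousAt_const ?_
      simpa [h0] using hb
    filter_upwards [h1] with y hy
    have := hle (y - x)
    rw [add_sub_cancel] at this
    exact this.trans_lt hy
  obtain ⟨x, -, hx⟩ := (husc.upperSemicontinuousOn (Set.Icc 0 1)).exists_isMaxOn
    (Set.nonempty_Icc.2 zero_le_one) isCompact_Icc
  refine ⟨x, fun y => ?_⟩
  obtain ⟨m, hm⟩ := exists_add_intVec_mem y
  rw [← hs.connectingAction_add_intVec y y m hT]
  exact hx hm

end ConjugateFree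

/-- First variation of the action along an extremal curve. -/
theorem IsExtremal.hasDerivAt_action {n : ℕ} {L : E n × E n → ℝ} (hL : ContDiff ℝ 2 L)
    {c η : ℝ → E n} (hc : IsExtremal n L c) (hη : ContDiff ℝ 2 η) (a b : ℝ) :
    HasDerivAt (fun r : ℝ => ∫ s in a..b, L (c s + r • η s, deriv c s + r • deriv η s))
      (partialV n L (c b) (deriv c b) (η b) - partialV n L (c a) (deriv c a) (η a)) 0 := by
  have hLd : Differentiable ℝ L := hL.differentiable (by norm_num)
  have hc' : ContDiff ℝ 1 (deriv c) := (contDiff_succ_iff_deriv (n := 1).1 hc.1).2.2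
  have hη' : ContDiff ℝ 1 (deriv η) := (contDiff_succ_iff_deriv (n := 1).1 hη).2.2
  have hc1 : ContDiff ℝ 1 c := hc.1.of_le (by norm_num)
  have hη1 : ContDiff ℝ 1 η := hη.of_le (by norm_num)
  have hg : ContDiff ℝ 1 fun q : ℝ × ℝ =>
      L (c q.2 + q.1 • η q.2, deriv c q.2 + q.1 • deriv η q.2) :=
    (hL.of_le (by norm_num)).comp
      (((hc1.comp contDiff_snd).add (contDiff_fst.smul (hη1.comp contDiff_snd))).prodMk
        ((hc'.comp contDiff_snd).add (contDiff_fst.smul (hη'.comp contDiff_snd))))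
  have h1 := (hasFDerivAt_intervalIntegral_of_contDiff hg a b 0).hasDerivAt
  have hI : Continuous fun s => (fderiv ℝ (fun q : ℝ × ℝ =>
      L (c q.2 + q.1 • η q.2, deriv c q.2 + q.1 • deriv η q.2)) (0, s)).comp
      (ContinuousLinearMap.inl ℝ ℝ ℝ) :=
    ((hg.continuous_fderiv (by norm_num)).comp (Continuous.prodMk_right (0:ℝ))).clm_comp
      continuous_const
  rw [ContinuousLinearMap.intervalIntegral_apply (hI.intervalIntegrable _ _)] at h1
  refine h1.congr_deriv (intervalIntegral.integral_eq_sub_of_hasDerivAt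
    (f := fun s => partialV n L (c s) (deriv c s) (η s)) (fun s _ => ?_)
    ((hI.clm_apply continuous_const).intervalIntegrable _ _))
  have h2 := (hc.2 s).clm_apply (hη1.differentiable (by norm_num) s).hasDerivAt
  have h3 : HasDerivAt (fun r : ℝ => L (c s + r • η s, deriv c s + r • deriv η s))
      (fderiv ℝ L (c s, deriv c s) (η s, deriv η s)) 0 := by
    have h4 : HasDerivAt (fun r : ℝ => (c s + r • η s, deriv c s + r • deriv η s))
        (η s, deriv η s) 0 := by
      have h5 := ((hasDerivAt_id (0:ℝ)).smul_const (η s)).const_add (c s)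
      have h6 := ((hasDerivAt_id (0:ℝ)).smul_const (deriv η s)).const_add (deriv c s)
      rw [one_smul] at h5 h6
      exact h5.prodMk h6
    have h7 : HasFDerivAt L (fderiv ℝ L (c s, deriv c s))
        (c s + (0:ℝ) • η s, deriv c s + (0:ℝ) • deriv η s) := by
      rw [zero_smul, zero_smul, add_zero, add_zero]
      exact (hLd _).hasFDerivAt
    exact h7.comp_hasDerivAt (0:ℝ) h4
  have h8 := ((hg.differentiable (by norm_num) (0, s)).hasFDerivAt.comp (0:ℝ)
    (hasFDerivAt_prodMk_left (0:ℝ) s)).hasDerivAt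
  have h9 := h8.unique h3
  rw [fderiv_eq_partial hLd] at h9
  exact h9 ▸ h2

namespace ConjugateFree

variable {n : ℕ} {L : E n × E n → ℝ} {φ : ℝ → E n × E n → E n × E n} (hs : ConjugateFree n L φ)

include hs

/-- A loop whose action is maximal among the extremal loops is a periodic curve. -/
theorem periodic_of_isMax {T : ℝ} (hT : 0 < T) {c : ℝ → E n} (hc : IsExtremal n L c)
    (hcT : c T = c 0)
    (hmax : ∀ y, connectingAction L φ T y y ≤ connectingAction L φ T (c 0) (c 0)) :
    Function.Periodic c T := by
  have hcont : Continuous fun s => L (c s, deriv c s) :=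
    hs.continuous_action_of_contDiff (hc.1.of_le (by norm_num))
  have hcrit : ∀ h : E n, partialV n L (c 0) (deriv c 0) h = partialV n L (c T) (deriv c T) h := by
    intro h
    have hη₁ : ContDiff ℝ 2 fun s : ℝ => (1 + T⁻¹ * s) • h :=
      (contDiff_const.add (contDiff_const.mul contDiff_id)).smul contDiff_const
    have hη₂ : ContDiff ℝ 2 fun s : ℝ => (2 - T⁻¹ * s) • h :=
      (contDiff_const.sub (contDiff_const.mul contDiff_id)).smul contDiff_const
    have hd := (hc.hasDerivAt_action hs.contDiff hη₁ (-T) 0).add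
      (hc.hasDerivAt_action hs.contDiff hη₂ T (2 * T))
    have hle : ∀ {η : ℝ → E n}, ContDiff ℝ 2 η → ∀ (r : ℝ) {a b : ℝ}, a < b →
        connectingAction L φ (b - a) (c a + r • η a) (c b + r • η b) ≤
          ∫ s in a..b, L (c s + r • η s, deriv c s + r • deriv η s) := by
      intro η hη r a b hab
      have h1 := hs.connectingAction_le_integral (σ := fun s => c s + r • η s)
        ((hc.1.add (hη.const_smul r)).of_le (by norm_num)) hab
      have h2 : ∀ s, deriv (fun s => c s + r • η s) s = deriv c s + r • deriv η s := fun s =>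
        ((hc.1.differentiable (by norm_num) s).hasDerivAt.add
          ((hη.differentiable (by norm_num) s).hasDerivAt.const_smul r)).deriv
      simpa only [h2] using h1
    have hmin : IsLocalMin (fun r : ℝ =>
        (∫ s in (-T)..0, L (c s + r • (1 + T⁻¹ * s) • h,
          deriv c s + r • deriv (fun s : ℝ => (1 + T⁻¹ * s) • h) s)) +
        ∫ s in T..(2 * T), L (c s + r • (2 - T⁻¹ * s) • h,
          deriv c s + r • deriv (fun s : ℝ => (2 - T⁻¹ * s) • h) s)) 0 := by
      refine Filter.Eventually.of_forall fun r => ?_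
      have h1 := hle hη₁ r (neg_lt_zero.2 hT)
      have h2 := hle hη₂ r (show T < 2 * T by linarith)
      have e1 : (2:ℝ) - T⁻¹ * (2 * T) = 0 := by field_simp; ring
      have e2 : (2:ℝ) - T⁻¹ * T = 1 := by field_simp; ring
      have e3 : (1:ℝ) + T⁻¹ * (-T) = 0 := by field_simp; ring
      have e4 : (2:ℝ) * T - T = T := by ring
      simp only [e1, e2, e3, e4, mul_zero, add_zero, zero_smul, smul_zero, one_smul, hcT,
        zero_sub, neg_neg] at h1 h2
      have h3 := hs.connectingAction_extremal hc (show -T < 2 * T by linarith)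
      have h4 := hs.connectingAction_extremal hc hT
      rw [show 2 * T - -T = T + (T + T) by ring] at h3
      rw [sub_zero, hcT] at h4
      have h5 := hs.connectingAction_add_le (c (-T)) (c 0 + r • h) (c (2 * T)) hT (add_pos hT hT)
      have h6 := hs.connectingAction_add_le (c 0 + r • h) (c 0 + r • h) (c (2 * T)) hT hT
      have h7 := hmax (c 0 + r • h)
      have h8 := intervalIntegral.integral_add_adjacent_intervals (μ := volume)
        (hcont.intervalIntegrable (-T) 0) (hcont.intervalIntegrable 0 T)
      have h9 := intervalIntegral.integral_add_adjacent_intervals (μ := volume)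
        (hcont.intervalIntegrable (-T) T) (hcont.intervalIntegrable T (2 * T))
      simp only [zero_smul, add_zero]
      linarith
    have h0 := hmin.hasDerivAt_eq_zero hd
    have e1 : (2:ℝ) - T⁻¹ * (2 * T) = 0 := by field_simp; ring
    have e2 : (2:ℝ) - T⁻¹ * T = 1 := by field_simp; ring
    have e3 : (1:ℝ) + T⁻¹ * (-T) = 0 := by field_simp; ring
    simp only [e1, e2, e3, mul_zero, add_zero, zero_smul, one_smul, map_zero] at h0
    linarith
  have hv : deriv c T = deriv c 0 := by
    refine partialV_injective hs.contDiff hs.posDef (c 0) ?_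
    refine ContinuousLinearMap.ext fun h => ?_
    rw [hcrit h, hcT]
  have := IsExtremal.eq_of_eq hs.contDiff hs.posDef (hc.comp_add_const T) hc (t₀ := 0)
    (by rw [zero_add, hcT]) (by rw [deriv_comp_add_const, zero_add, hv])
  exact fun t => congrFun this t

theorem connectingAction_loop_le (x : E n) {T : ℝ} (hT : 0 < T) (N : ℕ) :
    connectingAction L φ ((N + 1) * T) x x ≤ (N + 1) * connectingAction L φ T x x := by
  induction N with
  | zero => simp
  | succ N ih =>
    have h := hs.connectingAction_add_le x x x (t := (N + 1) * T) (by positivity) hT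
    rw [show ((N + 1 : ℕ) + 1 : ℝ) * T = (N + 1) * T + T by push_cast; ring]
    push_cast
    linarith

theorem connectingAction_loop_of_periodic {T : ℝ} (hT : 0 < T) {c : ℝ → E n}
    (hc : IsExtremal n L c) (hp : Function.Periodic c T) (N : ℕ) :
    connectingAction L φ ((N + 1) * T) (c 0) (c 0) =
      (N + 1) * connectingAction L φ T (c 0) (c 0) := by
  have hcont : Continuous fun s => L (c s, deriv c s) :=
    hs.continuous_action_of_contDiff (hc.1.of_le (by norm_num))
  have hd : ∀ s, deriv c (s + T) = deriv c s := fun s => by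
    rw [← deriv_comp_add_const]
    exact congrArg (fun f => deriv f s) (funext hp)
  have hLp : Function.Periodic (fun s => L (c s, deriv c s)) T := fun s => by
    simp only [hp s, hd s]
  have h1 := hs.connectingAction_extremal hc hT
  have h2 := hs.connectingAction_extremal hc (show (0:ℝ) < (N + 1) * T by positivity)
  have h3 : c ((N + 1) * T) = c 0 := by
    have := hp.nat_mul_eq (N + 1)
    push_cast at this
    exact this
  have h4 : c T = c 0 := hp.eq
  have h5 := hLp.intervalIntegral_add_zsmul_eq (N + 1) 0
    (fun a b => hcont.intervalIntegrable a b)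
  rw [sub_zero, h4] at h1
  rw [sub_zero, h3] at h2
  rw [h1, h2]
  simpa using h5

theorem connectingAction_loop_const {T : ℝ} (hT : 0 < T) (x y : E n) :
    connectingAction L φ T y y ≤ connectingAction L φ T x x := by
  obtain ⟨z, hz⟩ := hs.exists_isMax_connectingAction hT
  refine (hz y).trans ?_
  obtain ⟨v, hv⟩ := hs.exists_orbit_fst_eq z z hT
  have hc : IsExtremal n L fun t => (orbit φ z (t, v)).1 := hs.extremal (z, v)
  have h0 : (orbit φ z (0, v)).1 = z := by simp [orbit, hs.flow_zero]
  have hp := hs.periodic_of_isMax hT hc (by rw [hv, h0]) (by simpa only [h0] using hz)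
  by_contra! hlt
  obtain ⟨N, hN⟩ := exists_nat_gt ((connectingAction L φ T z x + connectingAction L φ T x z
    - 2 * connectingAction L φ T z z) /
    (connectingAction L φ T z z - connectingAction L φ T x x))
  rw [div_lt_iff₀ (sub_pos.2 hlt)] at hN
  have h1 := hs.connectingAction_loop_of_periodic hT hc hp (N + 2)
  have h2 := hs.connectingAction_loop_le x hT N
  have h3 := hs.connectingAction_add_le z x z hT (s := (N + 1) * T + T) (by positivity)
  have h4 := hs.connectingAction_add_le x x z (t := (N + 1) * T) (by positivity) hT
  rw [h0, show ((N + 2 : ℕ) + 1 : ℝ) * T = T + ((N + 1) * T + T) by push_cast; ring] at h1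
  push_cast at h1
  linarith

theorem periodic_of_loop {T : ℝ} (hT : 0 < T) {c : ℝ → E n} (hc : IsExtremal n L c)
    (hcT : c T = c 0) : Function.Periodic c T :=
  hs.periodic_of_isMax hT hc hcT fun y => hs.connectingAction_loop_const hT (c 0) y

theorem apply_div_of_loop {T : ℝ} (hT : 0 < T) {c : ℝ → E n} (hc : IsExtremal n L c)
    (hcT : c T = c 0) (m : ℕ) : c (T / (m + 1)) = c 0 := by
  have hm : 0 < T / (m + 1) := by positivity
  obtain ⟨v, hv⟩ := hs.exists_orbit_fst_eq (c 0) (c 0) hm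
  have hc' : IsExtremal n L fun t => (orbit φ (c 0) (t, v)).1 := hs.extremal (c 0, v)
  have h0 : (orbit φ (c 0) (0, v)).1 = c 0 := by simp [orbit, hs.flow_zero]
  have hp := (hs.periodic_of_loop hm hc' (by rw [hv, h0])).nat_mul_eq (m + 1)
  rw [show ((m + 1 : ℕ) : ℝ) * (T / (m + 1)) = T by push_cast; field_simp, h0] at hp
  have hc0 := hs.orbit_eq hc 0
  simp only [add_zero] at hc0
  have hvc : v = deriv c 0 := hs.orbit_fst_injective (c 0) hT (by rw [hp, hc0, hcT])
  rw [hvc, hc0] at hv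
  exact hv

theorem deriv_eq_zero_of_loop {T : ℝ} (hT : 0 < T) {c : ℝ → E n} (hc : IsExtremal n L c)
    (hcT : c T = c 0) : deriv c 0 = 0 := by
  have h1 := hasDerivAt_iff_tendsto_slope.1 (hc.hasDerivAt 0)
  have h2 : Filter.Tendsto (fun m : ℕ => T / ((m : ℝ) + 1)) Filter.atTop
      (nhdsWithin 0 {0}ᶜ) := by
    refine tendsto_nhdsWithin_iff.2 ⟨?_, Filter.Eventually.of_forall fun m => ?_⟩
    · simpa [div_eq_mul_inv] using
        (tendsto_one_div_add_atTop_nhds_zero_nat (𝕜 := ℝ)).const_mul T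
    · exact (show 0 < T / ((m : ℝ) + 1) by positivity).ne'
  refine tendsto_nhds_unique (h1.comp h2) (tendsto_const_nhds.congr fun m => ?_)
  simp [slope_def_module, hs.apply_div_of_loop hT hc hcT m]

end ConjugateFree

/-- For a Tonelli Lagrangian without conjugate points, every extremal
curve returning to its starting point in time `T` is constant at velocity `0`:
`Γ_{T,0}` is the zero section. -/
theorem zero_section (n k : ℕ) (hn : 1 ≤ n) (hk : 2 ≤ k)
    (L : E n × E n → ℝ) (hL : IsTonelliLagrangian n (k : ℕ∞) L)
    (φ : ℝ → E n × E n → E n × E n) (hφ : IsELFlow n k L φ)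
    (hnc : NoConjugatePoints n φ) :
    ∀ T : ℝ, 0 < T → ∀ x : E n, ∀ c : ℝ → E n,
      IsExtremal n L c → c 0 = x → c T = x → deriv c 0 = 0 := by
  intro T hT x c hc h0 hcT
  have hs : ConjugateFree n L φ :=
    { contDiff := hL.contDiff_two hk
      posDef := hL.posdef
      periodic := hL.periodic
      superlinear := hL.superlinear
      contDiff_flow := hφ.1.of_le
        (show ((1 : ℕ∞) : WithTop ℕ∞) ≤ _ from
          WithTop.coe_le_coe.2 (by exact_mod_cast Nat.le_sub_of_add_le hk))
      flow_zero := hφ.2.1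
      extremal := fun z => (hφ.2.2 z.1 z.2).1
      flow_snd := fun z t => (hφ.2.2 z.1 z.2).2 t
      noConj := hnc }
  exact hs.deriv_eq_zero_of_loop hT hc (hcT.trans h0.symm)

end
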